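/- arXiv:1805.06387 — 10 statements merged into one kernel-verified Lean document; each statement's English description precedes it below -/
import Mathlib

section
/- There exists a constant c > 0 such that for every N ≥ 2 the following holds. Consider the End-of-Line search problem with pointer representation on Fin N. For every function f that maps each input (S,P) to a solution of that input, there exists a critical input (S*,P*) (an input with exactly one solution) such that bs(f,(S*,P*)) ≥ c·N, where blocks are sets of pointer coordinates (among the 2N values S(v) and P(v) for v ∈ Fin N), and bs(f,x) is the maximum number b of pairwise disjoint sets B₁,…,B_b of pointer coordinates such that for each i there is an input x_i agreeing with x outside B_i with f(x_i) ≠ f(x). -/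
/-!
STATEMENT 0: Critical block sensitivity lower bound for End-of-Line
with pointer representation on `Fin N`.
-/

/-- An input to the End-of-Line problem with pointer representation:
a successor function and a predecessor function. -/
abbrev EoLInput (N : ℕ) := (Fin N → Option (Fin N)) × (Fin N → Option (Fin N))

/-- In-degree of `v` in the digraph determined by the input `x`:
the number of `u` with an edge `u → v`, i.e. `S u = some v` and `P v = some u`. -/
def eolIndeg {N : ℕ} (x : EoLInput N) (v : Fin N) : ℕ :=
  (Finset.univ.filter (fun u : Fin N => x.1 u = some v ∧ x.2 v = some u)).card

/-- Out-degree of `v` in the digraph determined by the input `x`. -/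
def eolOutdeg {N : ℕ} (x : EoLInput N) (v : Fin N) : ℕ :=
  (Finset.univ.filter (fun u : Fin N => x.1 v = some u ∧ x.2 u = some v)).card

/-- `v` is a solution of the input `x` (with distinguished start vertex `v₁`). -/
def EoLSolution {N : ℕ} (v₁ : Fin N) (x : EoLInput N) (v : Fin N) : Prop :=
  (v = v₁ ∧ ¬ (eolIndeg x v = 0 ∧ eolOutdeg x v = 1)) ∨
  (v ≠ v₁ ∧ ((eolIndeg x v = 1 ∧ eolOutdeg x v = 0) ∨
             (eolIndeg x v = 0 ∧ eolOutdeg x v = 1)))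

/-- An input is critical if it admits a unique solution. -/
def EoLCritical {N : ℕ} (v₁ : Fin N) (x : EoLInput N) : Prop :=
  ∃! v, EoLSolution v₁ x v

/-- `y` agrees with `x` outside the set `B` of pointer coordinates.
A coordinate `Sum.inl v` is the successor pointer `S v`, and
`Sum.inr v` is the predecessor pointer `P v`. -/
def AgreesOutside {N : ℕ} (x y : EoLInput N) (B : Set (Fin N ⊕ Fin N)) : Prop :=
  (∀ v : Fin N, Sum.inl v ∉ B → y.1 v = x.1 v) ∧
  (∀ v : Fin N, Sum.inr v ∉ B → y.2 v = x.2 v)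

/-- The input whose edges are `v → π v`, except that every vertex of `D` has lost its
incoming edge. -/
def permInput {N : ℕ} (π : Equiv.Perm (Fin N)) (D : Finset (Fin N)) : EoLInput N :=
  (fun v => if π v ∈ D then none else some (π v),
   fun w => if w ∈ D then none else some (π.symm w))

theorem permInput_edge_iff {N : ℕ} (π : Equiv.Perm (Fin N)) (D : Finset (Fin N)) (u v : Fin N) :
    ((permInput π D).1 u = some v ∧ (permInput π D).2 v = some u) ↔ π u = v ∧ v ∉ D := by
  simp only [permInput]
  constructor
  · rintro ⟨h, h'⟩
    split_ifs at h h'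
    simp_all
  · rintro ⟨rfl, h⟩
    simp [h]

theorem eolIndeg_permInput {N : ℕ} (π : Equiv.Perm (Fin N)) (D : Finset (Fin N)) (v : Fin N) :
    eolIndeg (permInput π D) v = if v ∈ D then 0 else 1 := by
  simp only [eolIndeg, permInput_edge_iff]
  split_ifs with h
  · simp [h]
  · rw [Finset.card_eq_one]
    exact ⟨π.symm v, by ext u; simp [h, Equiv.eq_symm_apply]⟩

theorem eolOutdeg_permInput {N : ℕ} (π : Equiv.Perm (Fin N)) (D : Finset (Fin N)) (v : Fin N) :
    eolOutdeg (permInput π D) v = if π v ∈ D then 0 else 1 := by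
  simp only [eolOutdeg, permInput_edge_iff]
  split_ifs with h
  · rw [Finset.card_eq_zero, Finset.filter_eq_empty_iff]
    rintro u - ⟨rfl, hu⟩
    exact hu h
  · rw [Finset.card_eq_one]
    refine ⟨π v, ?_⟩
    ext u
    simp only [Finset.mem_filter, Finset.mem_univ, true_and, Finset.mem_singleton]
    exact ⟨fun hu => hu.1.symm, by rintro rfl; exact ⟨rfl, h⟩⟩

/-- Deleting from a permutation only the edge into the start vertex leaves the tail of that
edge as the unique solution. -/
theorem eolSolution_permInput_singleton {N : ℕ} (z : Fin N) (π : Equiv.Perm (Fin N)) (v : Fin N) :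
    EoLSolution z (permInput π {z}) v ↔ v = π.symm z := by
  simp only [EoLSolution, eolIndeg_permInput, eolOutdeg_permInput, Finset.mem_singleton,
    Equiv.eq_symm_apply]
  by_cases h : v = z <;> by_cases h' : π v = z <;> simp [h, h']

theorem permInput_swap_mul {N : ℕ} (z w : Fin N) (π : Equiv.Perm (Fin N)) :
    permInput (Equiv.swap z w * π) {z, w} = permInput π {z, w} := by
  have hmem (a : Fin N) : Equiv.swap z w a ∈ ({z, w} : Finset (Fin N)) ↔ a ∈ ({z, w} : Finset _) := by
    simp only [Finset.mem_insert, Finset.mem_singleton, Equiv.swap_apply_eq_iff,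
      Equiv.swap_apply_left, Equiv.swap_apply_right, or_comm]
  have hfix (a : Fin N) (ha : a ∉ ({z, w} : Finset (Fin N))) : Equiv.swap z w a = a := by
    simp only [Finset.mem_insert, Finset.mem_singleton, not_or] at ha
    exact Equiv.swap_apply_of_ne_of_ne ha.1 ha.2
  refine Prod.ext (funext fun v => ?_) (funext fun v => ?_)
  · simp only [permInput, Equiv.Perm.mul_apply, hmem]
    split_ifs with h
    · rfl
    · rw [hfix _ h]
  · simp only [permInput]
    split_ifs with h
    · rfl
    · congr 1
      rw [Equiv.symm_apply_eq]
      simp [hfix _ h]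

/-- For each `w ≠ z`, multiplication by `swap z w` pairs up the permutations so that, in each
pair, deleting the edge into `w` is a sensitive change for at least one member. -/
theorem card_perm_le_two_mul_card_sensitive {N : ℕ} (z w : Fin N) (hw : w ≠ z)
    (f : EoLInput N → Fin N) :
    Fintype.card (Equiv.Perm (Fin N)) ≤
      2 * (Finset.univ.filter fun π : Equiv.Perm (Fin N) =>
        f (permInput π {z, w}) ≠ π.symm z).card := by
  set A := Finset.univ.filter fun π : Equiv.Perm (Fin N) => f (permInput π {z, w}) ≠ π.symm z
    with hA
  have hle : Aᶜ.card ≤ A.card := by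
    refine Finset.card_le_card_of_injOn (fun π => Equiv.swap z w * π) ?_
      (fun _ _ _ _ h => mul_left_cancel h)
    intro π hπ
    simp only [hA, Finset.coe_compl, Finset.coe_filter, Finset.mem_univ, true_and,
      Set.mem_compl_iff, Set.mem_ofPred_eq, not_not] at hπ
    simp only [hA, Finset.coe_filter, Finset.mem_univ, true_and, Set.mem_ofPred_eq,
      permInput_swap_mul, hπ]
    intro h
    rw [Equiv.eq_symm_apply] at h
    simp [hw] at h
  have := Finset.card_add_card_compl A
  omega

theorem exists_perm_many_sensitive {N : ℕ} (z : Fin N) (f : EoLInput N → Fin N) :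
    ∃ π : Equiv.Perm (Fin N), N - 1 ≤
      2 * ((Finset.univ.erase z).filter fun w => f (permInput π {z, w}) ≠ π.symm z).card := by
  by_contra! h
  have hlt := Finset.sum_lt_sum_of_nonempty (s := Finset.univ) Finset.univ_nonempty
    fun π _ => h π
  have hle := Finset.sum_le_sum fun w (hw : w ∈ Finset.univ.erase z) =>
    card_perm_le_two_mul_card_sensitive z w (Finset.ne_of_mem_erase hw) f
  simp only [← Finset.mul_sum, Finset.card_filter, Finset.sum_const, smul_eq_mul] at hlt hle
  rw [Finset.sum_comm, Finset.card_univ] at hlt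
  rw [Finset.card_erase_of_mem (Finset.mem_univ z), Finset.card_univ, Fintype.card_fin,
    mul_comm] at hle
  omega

theorem agreesOutside_permInput_insert {N : ℕ} (z w : Fin N) (π : Equiv.Perm (Fin N)) :
    AgreesOutside (permInput π {z}) (permInput π {z, w})
      {Sum.inl (π.symm w), Sum.inr w} := by
  constructor
  · intro v hv
    have : π v ≠ w := by simpa [Equiv.eq_symm_apply] using hv
    simp [permInput, this]
  · intro v hv
    have : v ≠ w := by simpa using hv
    simp [permInput, this]

/-- There exists `c > 0` such that for every `N ≥ 2` and every `f` solving the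
End-of-Line search problem (with pointer representation, start vertex `0`),
there is a critical input `x` with block sensitivity at least `c·N`:
at least `c·N` pairwise disjoint blocks of pointer coordinates, each of which
can be altered (keeping everything outside the block fixed) so as to change
the value of `f`. -/
theorem stmt0 :
    ∃ c : ℝ, 0 < c ∧
      ∀ (N : ℕ) (hN : 2 ≤ N),
        ∀ f : EoLInput N → Fin N,
          (∀ x, EoLSolution (⟨0, by omega⟩ : Fin N) x (f x)) →
          ∃ x : EoLInput N, EoLCritical (⟨0, by omega⟩ : Fin N) x ∧
            ∃ (b : ℕ) (B : Fin b → Set (Fin N ⊕ Fin N)) (y : Fin b → EoLInput N),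
              c * N ≤ (b : ℝ) ∧
              (∀ i j, i ≠ j → Disjoint (B i) (B j)) ∧
              (∀ i, AgreesOutside x (y i) (B i)) ∧
              (∀ i, f (y i) ≠ f x) := by
  refine ⟨1 / 4, by norm_num, fun N hN f hf => ?_⟩
  generalize hz : (⟨0, by omega⟩ : Fin N) = z at hf ⊢
  obtain ⟨π, hπ⟩ := exists_perm_many_sensitive z f
  set W := (Finset.univ.erase z).filter fun w => f (permInput π {z, w}) ≠ π.symm z with hW
  have hfx : f (permInput π {z}) = π.symm z := (eolSolution_permInput_singleton z π _).1 (hf _)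
  refine ⟨permInput π {z}, ⟨π.symm z, (eolSolution_permInput_singleton z π _).2 rfl,
    fun v => (eolSolution_permInput_singleton z π v).1⟩, W.card,
    fun i => {Sum.inl (π.symm (W.equivFin.symm i)), Sum.inr (W.equivFin.symm i : Fin N)},
    fun i => permInput π {z, (W.equivFin.symm i : Fin N)}, ?_, ?_, ?_, ?_⟩
  · have : (N : ℝ) ≤ 4 * W.card := by exact_mod_cast (by omega : N ≤ 4 * W.card)
    linarith
  · intro i j hij
    have : (W.equivFin.symm i : Fin N) ≠ W.equivFin.symm j := fun h =>
      hij (W.equivFin.symm.injective (Subtype.ext h))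
    simp [this.symm]
  · exact fun i => agreesOutside_permInput_insert z _ π
  · intro i
    rw [hfx]
    exact (Finset.mem_filter.1 (W.equivFin.symm i).2).2
end

section
/- There exist a degree bound d ∈ ℕ and constants c, C > 0 such that for every sufficiently large N there is a digraph H on vertex set Fin N with a distinguished vertex v₀, in which every vertex has in-degree at most d and out-degree at most d, such that the critical block sensitivity of QEoL_H is at least c·N/(log N)^C; i.e., for every function f mapping each x ∈ {0,1}^{E(H)} to a solution of x, there exists a critical input x* (an input with exactly one solution) and at least c·N/(log N)^C pairwise disjoint sets B₁,…,B_b ⊆ E(H) such that f(x*^{B_i}) ≠ f(x*) for each i, where x*^{B} denotes x* with all bits in B flipped. -/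
/-!
STATEMENT 1: A bounded-degree host digraph `H` on `Fin N` for which the
critical block sensitivity of `QEoL_H` is at least `c·N/(log N)^C`.
-/

/-- In-degree of `v` in the spanning subgraph `G_x` of the host graph with edge
set `EH`, where `x : {e // e ∈ EH} → Bool` selects the edges. -/
def qIndeg {N : ℕ} (EH : Finset (Fin N × Fin N)) (x : {e // e ∈ EH} → Bool)
    (v : Fin N) : ℕ :=
  (Finset.univ.filter (fun e : {e // e ∈ EH} => e.1.2 = v ∧ x e = true)).card

/-- Out-degree of `v` in the spanning subgraph `G_x`. -/
def qOutdeg {N : ℕ} (EH : Finset (Fin N × Fin N)) (x : {e // e ∈ EH} → Bool)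
    (v : Fin N) : ℕ :=
  (Finset.univ.filter (fun e : {e // e ∈ EH} => e.1.1 = v ∧ x e = true)).card

/-- `v` is a solution of the input `x` to `QEoL_H` with distinguished vertex `v₀`. -/
def QSolution {N : ℕ} (EH : Finset (Fin N × Fin N)) (v₀ : Fin N)
    (x : {e // e ∈ EH} → Bool) (v : Fin N) : Prop :=
  (v = v₀ ∧ ¬ (qIndeg EH x v = 0 ∧ qOutdeg EH x v = 1)) ∨
  (v ≠ v₀ ∧ 1 ≤ qIndeg EH x v + qOutdeg EH x v ∧
    ¬ (qIndeg EH x v = 1 ∧ qOutdeg EH x v = 1))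

/-- An input is critical if it has exactly one solution. -/
def QCritical {N : ℕ} (EH : Finset (Fin N × Fin N)) (v₀ : Fin N)
    (x : {e // e ∈ EH} → Bool) : Prop :=
  ∃! v, QSolution EH v₀ x v

/-- `x` with all bits in `B` flipped. -/
def flipBits {N : ℕ} (EH : Finset (Fin N × Fin N)) (x : {e // e ∈ EH} → Bool)
    (B : Finset {e // e ∈ EH}) : {e // e ∈ EH} → Bool :=
  fun e => if e ∈ B then !(x e) else x e

open Finset in
/-- Random cutting and rewiring of a routed permutation. A triple `(π, ρ, b)` routes every link
`s → π s` through `ρ s`. If few routes of any link conflict with the others, and each cut link `b`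
is sensitive either in `π` or in `π` rewired at `b` and `π⁻¹ v₀`, then some
conflict-free routing has many sensitive links. -/
theorem exists_routing_many_sensitive {T R : Type*} [Fintype T] [DecidableEq T] [Fintype R]
    (v₀ : T) (K : T × R × T → T × R × T → Prop) (hK : ∀ p q, K p q → K q p)
    (hblock : ∀ (π : Equiv.Perm T) (ρ : T → R) (b : T),
      4 * Nat.card {r : R // ∃ s, s ≠ b ∧ K (b, r, π b) (s, ρ s, π s)} ≤ Fintype.card R)
    (hex : ∃ (π : Equiv.Perm T) (ρ : T → R), ∀ s s', s ≠ s' →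
      ¬ K (s, ρ s, π s) (s', ρ s', π s'))
    (Sens : Equiv.Perm T → (T → R) → T → Prop)
    (hSens : ∀ π ρ b, b ≠ π.symm v₀ →
      Sens π ρ b ∨ Sens (π * Equiv.swap b (π.symm v₀)) ρ (π.symm v₀)) :
    ∃ (π : Equiv.Perm T) (ρ : T → R),
      (∀ s s', s ≠ π.symm v₀ → s' ≠ π.symm v₀ → s ≠ s' →
        ¬ K (s, ρ s, π s) (s', ρ s', π s')) ∧
      Fintype.card T ≤ 4 * Nat.card {b : T // b ≠ π.symm v₀ ∧ Sens π ρ b} + 1 := by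
  classical
  let d : (Equiv.Perm T × (T → R) × T) → T := fun τ => τ.1.symm v₀
  let P : Finset (Equiv.Perm T × (T → R) × T) := univ.filter fun τ => τ.2.2 ≠ d τ ∧
    ∀ s s', s ≠ τ.2.2 → s ≠ d τ → s' ≠ τ.2.2 → s' ≠ d τ → s ≠ s' →
      ¬ K (s, τ.2.1 s, τ.1 s) (s', τ.2.1 s', τ.1 s')
  let bad : (Equiv.Perm T × (T → R) × T) → Prop := fun τ => ∃ s, s ≠ τ.2.2 ∧ s ≠ d τ ∧
    K (τ.2.2, τ.2.1 τ.2.2, τ.1 τ.2.2) (s, τ.2.1 s, τ.1 s)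
  let Bad : Finset (Equiv.Perm T × (T → R) × T) := P.filter bad
  let S : Finset (Equiv.Perm T × (T → R) × T) := P.filter fun τ => ¬ bad τ ∧ Sens τ.1 τ.2.1 τ.2.2
  let φ : (Equiv.Perm T × (T → R) × T) → (Equiv.Perm T × (T → R) × T) := fun τ => (τ.1 * Equiv.swap τ.2.2 (d τ), τ.2.1, d τ)
  have hdφ : ∀ τ, d (φ τ) = τ.2.2 := by
    intro τ
    simp [d, φ, Equiv.symm_apply_eq]
  have hφφ : ∀ τ, φ (φ τ) = τ := by
    intro τ
    have h := hdφ τ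
    ext1
    · change (φ τ).1 * Equiv.swap (φ τ).2.2 (d (φ τ)) = τ.1
      rw [h]
      simp [φ, mul_assoc, Equiv.swap_comm]
    · ext1
      · rfl
      · exact h
  have hφinj : Function.Injective φ := Function.Involutive.injective hφφ
  have hφP : ∀ τ ∈ P, φ τ ∈ P := by
    intro τ hτ
    simp only [P, mem_filter, mem_univ, true_and] at hτ ⊢
    rw [hdφ]
    refine ⟨hτ.1.symm, ?_⟩
    intro s s' h1 h2 h3 h4 h5
    have := hτ.2 s s' h2 h1 h4 h3 h5
    simpa [φ, Equiv.swap_apply_of_ne_of_ne h2 h1, Equiv.swap_apply_of_ne_of_ne h4 h3] using this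
  have hR : 0 < Fintype.card R := by
    obtain ⟨_, ρ, _⟩ := hex
    exact Fintype.card_pos_iff.2 ⟨ρ v₀⟩
  have hBad : 4 * #Bad ≤ #P := by
    refine Nat.le_of_mul_le_mul_right ?_ hR
    let Q : Finset (Σ _ : Equiv.Perm T × (T → R) × T, R) := P.sigma fun τ => univ.filter fun r =>
      ∃ s, s ≠ τ.2.2 ∧ K (τ.2.2, r, τ.1 τ.2.2) (s, τ.2.1 s, τ.1 s)
    have h1 : #(Bad ×ˢ (univ : Finset R)) ≤ #Q := by
      refine card_le_card_of_injOn
        (fun p => ⟨(p.1.1, Function.update p.1.2.1 p.1.2.2 p.2, p.1.2.2), p.1.2.1 p.1.2.2⟩) ?_ ?_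
      · rintro ⟨⟨π, ρ, b⟩, r⟩ h
        simp only [coe_product, Set.mem_prod, mem_coe, Bad, P, mem_filter, mem_univ, true_and,
          bad, coe_univ, Set.mem_univ, and_true, d] at h
        obtain ⟨⟨hb, hv⟩, s, hs, hsd, hKs⟩ := h
        simp only [Q, coe_sigma, Set.mem_sigma_iff, mem_coe, P, mem_filter, mem_univ, true_and, d]
        refine ⟨⟨hb, ?_⟩, s, hs, ?_⟩
        · intro s s' h1 h2 h3 h4 h5
          simpa [Function.update_of_ne h1, Function.update_of_ne h3] using hv s s' h1 h2 h3 h4 h5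
        · simpa [Function.update_of_ne hs] using hKs
      · rintro ⟨⟨π, ρ, b⟩, r⟩ h ⟨⟨π', ρ', b'⟩, r'⟩ h' he
        simp only [Sigma.mk.injEq, Prod.mk.injEq, heq_eq_eq] at he
        obtain ⟨⟨rfl, h1, rfl⟩, h2⟩ := he
        have h3 : ρ = ρ' := by
          have := congrArg (fun g => Function.update g b (ρ b)) h1
          simp only [Function.update_idem, Function.update_eq_self] at this
          rw [this, h2, Function.update_eq_self]
        have h4 : r = r' := by simpa using congrFun h1 b
        rw [h3, h4]
    have h2 : 4 * #Q ≤ #P * Fintype.card R := by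
      rw [card_sigma, mul_sum]
      refine sum_le_card_nsmul _ _ _ ?_
      intro τ _
      have := hblock τ.1 τ.2.1 τ.2.2
      rwa [Nat.card_eq_fintype_card, Fintype.card_subtype] at this
    rw [card_product, card_univ] at h1
    calc _ = 4 * (#Bad * Fintype.card R) := by ring
      _ ≤ _ := (Nat.mul_le_mul_left 4 h1).trans h2
  have hcover : P ⊆ (Bad ∪ S) ∪ ((Bad ∪ S).image φ) := by
    intro τ hτ
    have hφτ := hφP τ hτ
    by_cases hb : bad τ
    · simp [Bad, hτ, hb]
    by_cases hb' : bad (φ τ)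
    · exact mem_union_right _ (mem_image.2 ⟨φ τ, by simp [Bad, hφτ, hb'], hφφ τ⟩)
    have hne : τ.2.2 ≠ d τ := (mem_filter.1 hτ).2.1
    rcases hSens τ.1 τ.2.1 τ.2.2 hne with h | h
    · simp [S, hτ, hb, h]
    · exact mem_union_right _ (mem_image.2 ⟨φ τ, by
        refine mem_union_right _ (mem_filter.2 ⟨hφτ, hb', h⟩), hφφ τ⟩)
  have hPS : #P ≤ 4 * #S := by
    have h1 := card_le_card hcover
    have h2 := card_union_le (Bad ∪ S) ((Bad ∪ S).image φ)
    have h3 : #((Bad ∪ S).image φ) ≤ #(Bad ∪ S) := card_image_le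
    have h4 := card_union_le Bad S
    omega
  by_contra! hcon
  let Val : Finset (Equiv.Perm T × (T → R)) := univ.filter fun c =>
    ∀ s s', s ≠ c.1.symm v₀ → s' ≠ c.1.symm v₀ → s ≠ s' →
        ¬ K (s, c.2 s, c.1 s) (s', c.2 s', c.1 s')
  have hVal : Val.Nonempty := by
    obtain ⟨π, ρ, h⟩ := hex
    exact ⟨(π, ρ), by simpa [Val] using fun s s' _ _ => h s s'⟩
  have hS : #S ≤ ∑ c ∈ Val, #(univ.filter fun b => b ≠ c.1.symm v₀ ∧ Sens c.1 c.2 b) := by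
    rw [← card_sigma]
    refine card_le_card_of_injOn (fun τ => ⟨(τ.1, τ.2.1), τ.2.2⟩) ?_ ?_
    · rintro ⟨π, ρ, b⟩ h
      simp only [S, P, mem_filter, mem_univ, true_and, bad, d, mem_coe] at h
      obtain ⟨⟨hb, hv⟩, hbad, hs⟩ := h
      simp only [coe_sigma, Set.mem_sigma_iff, mem_coe, Val, mem_filter, mem_univ, true_and]
      refine ⟨?_, hb, hs⟩
      intro s s' h1 h2 h3 hk
      push Not at hbad
      by_cases e1 : s = b
      · subst e1
        exact hbad s' (Ne.symm h3) h2 hk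
      by_cases e2 : s' = b
      · subst e2
        exact hbad s h3 h1 (hK _ _ hk)
      exact hv s s' e1 h1 e2 h2 h3 hk
    · rintro ⟨π, ρ, b⟩ _ ⟨π', ρ', b'⟩ _ he
      simp only [Sigma.mk.injEq, Prod.mk.injEq, heq_eq_eq] at he
      obtain ⟨⟨rfl, rfl⟩, rfl⟩ := he
      rfl
  have hP : ∑ c ∈ Val, (Fintype.card T - 1) ≤ #P := by
    have : ∀ c ∈ Val, Fintype.card T - 1 = #(univ.erase (c.1.symm v₀)) := by
      intro c _
      rw [card_erase_of_mem (mem_univ _), card_univ]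
    rw [sum_congr rfl this, ← card_sigma]
    refine card_le_card_of_injOn (fun q => (q.1.1, q.1.2, q.2)) ?_ ?_
    · rintro ⟨⟨π, ρ⟩, b⟩ h
      simp only [coe_sigma, Set.mem_sigma_iff, mem_coe, Val, mem_filter, mem_univ, true_and,
        mem_erase, and_true] at h
      simp only [P, mem_coe, mem_filter, mem_univ, true_and, d]
      exact ⟨h.2, fun s s' _ h1 _ h2 h3 => h.1 s s' h1 h2 h3⟩
    · rintro ⟨⟨π, ρ⟩, b⟩ _ ⟨⟨π', ρ'⟩, b'⟩ _ he
      simp only [Prod.mk.injEq] at he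
      obtain ⟨rfl, rfl, rfl⟩ := he
      rfl
  have hlt : ∑ c ∈ Val, 4 * #(univ.filter fun b => b ≠ c.1.symm v₀ ∧ Sens c.1 c.2 b) <
      ∑ c ∈ Val, (Fintype.card T - 1) := by
    refine sum_lt_sum_of_nonempty hVal ?_
    intro c hc
    have := hcon c.1 c.2 (mem_filter.1 hc).2
    rw [Nat.card_eq_fintype_card, Fintype.card_subtype] at this
    omega
  rw [← mul_sum] at hlt
  omega

section PathSystem

variable {N : ℕ} {T : Type*}

open Classical in
/-- The input whose edges are those of the walks `p s 0, …, p s L` for `s ∈ A`. -/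
noncomputable def pathInput (EH : Finset (Fin N × Fin N)) (L : ℕ) (p : T → ℕ → Fin N)
    (A : Set T) : {e // e ∈ EH} → Bool :=
  fun e => decide (∃ s ∈ A, ∃ l < L, e.1 = (p s l, p s (l + 1)))

variable {EH : Finset (Fin N × Fin N)} {L : ℕ} {p : T → ℕ → Fin N} {A : Set T}

theorem qOutdeg_pathInput_eq_one (hE : ∀ s, ∀ l < L, (p s l, p s (l + 1)) ∈ EH)
    (h : ∀ s ∈ A, ∀ s' ∈ A, ∀ l < L, ∀ l' < L, p s l = p s' l' → s = s' ∧ l = l')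
    {s : T} (hs : s ∈ A) {l : ℕ} (hl : l < L) :
    qOutdeg EH (pathInput EH L p A) (p s l) = 1 := by
  rw [qOutdeg, Finset.card_eq_one]
  refine ⟨⟨_, hE s l hl⟩, ?_⟩
  ext e
  simp only [Finset.mem_filter, Finset.mem_univ, true_and, Finset.mem_singleton]
  simp only [pathInput, decide_eq_true_eq]
  constructor
  · rintro ⟨h1, s', hs', l', hl', he⟩
    rw [he] at h1
    obtain ⟨rfl, rfl⟩ := h s' hs' s hs l' hl' l hl h1
    exact Subtype.ext he
  · rintro rfl
    exact ⟨rfl, s, hs, l, hl, rfl⟩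

theorem qIndeg_pathInput_eq_one (hE : ∀ s, ∀ l < L, (p s l, p s (l + 1)) ∈ EH)
    (h : ∀ s ∈ A, ∀ s' ∈ A, ∀ l < L, ∀ l' < L, p s (l + 1) = p s' (l' + 1) → s = s' ∧ l = l')
    {s : T} (hs : s ∈ A) {l : ℕ} (hl : l < L) :
    qIndeg EH (pathInput EH L p A) (p s (l + 1)) = 1 := by
  rw [qIndeg, Finset.card_eq_one]
  refine ⟨⟨_, hE s l hl⟩, ?_⟩
  ext e
  simp only [Finset.mem_filter, Finset.mem_univ, true_and, Finset.mem_singleton]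
  simp only [pathInput, decide_eq_true_eq]
  constructor
  · rintro ⟨h1, s', hs', l', hl', he⟩
    rw [he] at h1
    obtain ⟨rfl, rfl⟩ := h s' hs' s hs l' hl' l hl h1
    exact Subtype.ext he
  · rintro rfl
    exact ⟨rfl, s, hs, l, hl, rfl⟩

theorem qOutdeg_pathInput_eq_zero {v : Fin N} (h : ∀ s ∈ A, ∀ l < L, p s l ≠ v) :
    qOutdeg EH (pathInput EH L p A) v = 0 := by
  rw [qOutdeg, Finset.card_eq_zero, Finset.filter_eq_empty_iff]
  simp only [Finset.mem_univ, true_implies, pathInput, decide_eq_true_eq]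
  rintro e ⟨h1, s, hs, l, hl, he⟩
  rw [he] at h1
  exact h s hs l hl h1

theorem qIndeg_pathInput_eq_zero {v : Fin N} (h : ∀ s ∈ A, ∀ l < L, p s (l + 1) ≠ v) :
    qIndeg EH (pathInput EH L p A) v = 0 := by
  rw [qIndeg, Finset.card_eq_zero, Finset.filter_eq_empty_iff]
  simp only [Finset.mem_univ, true_implies, pathInput, decide_eq_true_eq]
  rintro e ⟨h1, s, hs, l, hl, he⟩
  rw [he] at h1
  exact h s hs l hl h1

/-- Disjoint walks realizing all links `s → π s` of a permutation except the one into `v₀`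
form a critical input, with solution the terminal `π⁻¹ v₀`. -/
theorem qSolution_pathInput_iff {π : Equiv.Perm T} {v₀ : T} {vt : T → Fin N}
    (hL : 0 < L)
    (hE : ∀ s, ∀ l < L, (p s l, p s (l + 1)) ∈ EH)
    (hvt : Function.Injective vt)
    (hp0 : ∀ s, p s 0 = vt s) (hpL : ∀ s, p s L = vt (π s))
    (hint : ∀ s u l, 0 < l → l < L → p s l ≠ vt u)
    (hlev : ∀ s s' l l', l < L → l' < L → p s l = p s' l' → l = l')
    (hinj : ∀ s s' l, s ≠ π.symm v₀ → s' ≠ π.symm v₀ → l ≤ L → p s l = p s' l → s = s')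
    (v : Fin N) :
    QSolution EH (vt v₀) (pathInput EH L p {s | s ≠ π.symm v₀}) v ↔ v = vt (π.symm v₀) := by
  set d := π.symm v₀ with hd
  have hπd : π d = v₀ := by simp [hd]
  set A : Set T := {s | s ≠ d}
  have htail : ∀ s ∈ A, ∀ s' ∈ A, ∀ l < L, ∀ l' < L, p s l = p s' l' → s = s' ∧ l = l' := by
    intro s hs s' hs' l hl l' hl' h
    obtain rfl := hlev _ _ _ _ hl hl' h
    exact ⟨hinj _ _ _ hs hs' hl.le h, rfl⟩
  have hhead : ∀ s ∈ A, ∀ s' ∈ A, ∀ l < L, ∀ l' < L,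
      p s (l + 1) = p s' (l' + 1) → s = s' ∧ l = l' := by
    intro s hs s' hs' l hl l' hl' h
    have hll : l = l' := by
      rcases Nat.lt_or_ge (l + 1) L with h1 | h1 <;> rcases Nat.lt_or_ge (l' + 1) L with h2 | h2
      · have := hlev _ _ _ _ h1 h2 h
        omega
      · obtain rfl : l' + 1 = L := by omega
        rw [hpL] at h
        exact absurd h (hint _ _ _ (by omega) h1)
      · obtain rfl : l + 1 = L := by omega
        rw [hpL] at h
        exact absurd h.symm (hint _ _ _ (by omega) h2)
      · omega
    subst hll
    exact ⟨hinj _ _ _ hs hs' hl h, rfl⟩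
  have hout1 := fun {s} (hs : s ∈ A) {l} (hl : l < L) =>
    qOutdeg_pathInput_eq_one hE htail hs hl
  have hin1 := fun {s} (hs : s ∈ A) {l} (hl : l < L) =>
    qIndeg_pathInput_eq_one hE hhead hs hl
  have hinT : ∀ u, u ≠ v₀ → qIndeg EH (pathInput EH L p A) (vt u) = 1 := by
    intro u hu
    have hs : π.symm u ∈ A := by
      simpa [A, hd] using hu
    have := hin1 hs (l := L - 1) (by omega)
    rwa [Nat.sub_add_cancel hL, hpL, Equiv.apply_symm_apply] at this
  have houtT : ∀ u, u ≠ d → qOutdeg EH (pathInput EH L p A) (vt u) = 1 := by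
    intro u hu
    have := hout1 (s := u) hu hL
    rwa [hp0] at this
  have hout0 : qOutdeg EH (pathInput EH L p A) (vt d) = 0 := by
    refine qOutdeg_pathInput_eq_zero ?_
    intro s hs l hl h
    rcases Nat.eq_zero_or_pos l with rfl | h0
    · rw [hp0] at h
      exact hs (hvt h)
    · exact hint _ _ _ h0 hl h
  have hin0 : qIndeg EH (pathInput EH L p A) (vt v₀) = 0 := by
    refine qIndeg_pathInput_eq_zero ?_
    intro s hs l hl h
    rcases Nat.lt_or_ge (l + 1) L with h1 | h1
    · exact hint _ _ _ (by omega) h1 h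
    · obtain rfl : l + 1 = L := by omega
      rw [hpL] at h
      apply hs
      rw [hd, Equiv.eq_symm_apply]
      exact hvt h
  constructor
  · intro hsol
    by_contra hvd
    rcases hsol with ⟨rfl, h⟩ | ⟨hv0, hpos, h⟩
    · exact h ⟨hin0, houtT _ fun e => hvd (by rw [← e])⟩
    have hmid : ∀ s ∈ A, ∀ l, 0 < l → l < L → v = p s l → False := by
      rintro s hs l hl0 hl rfl
      refine h ⟨?_, hout1 hs hl⟩
      have := hin1 hs (l := l - 1) (by omega)
      rwa [Nat.sub_add_cancel hl0] at this
    have hter : ∀ u, v = vt u → False := by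
      rintro u rfl
      exact h ⟨hinT u fun e => hv0 (by rw [e]), houtT u fun e => hvd (by rw [e])⟩
    have h1 : qOutdeg EH (pathInput EH L p A) v = 0 := by
      refine qOutdeg_pathInput_eq_zero ?_
      rintro s hs l hl rfl
      rcases Nat.eq_zero_or_pos l with rfl | h0
      · exact hter s (hp0 s)
      · exact hmid s hs l h0 hl rfl
    have h2 : qIndeg EH (pathInput EH L p A) v = 0 := by
      refine qIndeg_pathInput_eq_zero ?_
      rintro s hs l hl rfl
      rcases Nat.lt_or_ge (l + 1) L with h1 | h1
      · exact hmid s hs (l + 1) (by omega) h1 rfl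
      · obtain rfl : l + 1 = L := by omega
        exact hter _ (hpL s)
    omega
  · rintro rfl
    by_cases hdv : d = v₀
    · refine Or.inl ⟨by rw [hdv], ?_⟩
      rw [hout0]
      simp
    · refine Or.inr ⟨fun e => hdv (hvt e), ?_, ?_⟩
      · rw [hinT d hdv]
        omega
      · rw [hout0]
        simp

open Classical in
/-- The edges of the walk `p s 0, …, p s L`. -/
noncomputable def pathBlock (EH : Finset (Fin N × Fin N)) (L : ℕ) (p : T → ℕ → Fin N) (s : T) :
    Finset {e // e ∈ EH} :=
  Finset.univ.filter fun e => ∃ l < L, e.1 = (p s l, p s (l + 1))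

theorem disjoint_pathBlock
    (h : ∀ s ∈ A, ∀ s' ∈ A, ∀ l < L, ∀ l' < L, p s l = p s' l' → s = s')
    {s s' : T} (hs : s ∈ A) (hs' : s' ∈ A) (hne : s ≠ s') :
    Disjoint (pathBlock EH L p s) (pathBlock EH L p s') := by
  rw [Finset.disjoint_left]
  intro e he he'
  simp only [pathBlock, Finset.mem_filter, Finset.mem_univ, true_and] at he he'
  obtain ⟨l, hl, he⟩ := he
  obtain ⟨l', hl', he'⟩ := he'
  exact hne (h s hs s' hs' l hl l' hl' (congrArg Prod.fst (he.symm.trans he')))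

theorem flipBits_pathInput_pathBlock
    (h : ∀ s ∈ A, ∀ s' ∈ A, ∀ l < L, ∀ l' < L, p s l = p s' l' → s = s')
    {b : T} (hb : b ∈ A) :
    flipBits EH (pathInput EH L p A) (pathBlock EH L p b) = pathInput EH L p (A \ {b}) := by
  funext e
  unfold flipBits
  split_ifs with he
  · simp only [pathBlock, Finset.mem_filter, Finset.mem_univ, true_and] at he
    obtain ⟨l, hl, he⟩ := he
    have h1 : pathInput EH L p A e = true := by
      simp only [pathInput, decide_eq_true_eq]
      exact ⟨b, hb, l, hl, he⟩
    rw [h1, eq_comm, Bool.not_true]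
    simp only [pathInput, decide_eq_false_iff_not]
    rintro ⟨s, ⟨hs, hsb⟩, l', hl', he'⟩
    exact hsb (h s hs b hb l' hl' l hl (congrArg Prod.fst (he'.symm.trans he)))
  · simp only [pathInput]
    congr 1
    apply propext
    constructor
    · rintro ⟨s, hs, l, hl, hel⟩
      refine ⟨s, ⟨hs, ?_⟩, l, hl, hel⟩
      rintro rfl
      exact he (by simpa [pathBlock] using ⟨l, hl, hel⟩)
    · rintro ⟨s, hs, l, hl, hel⟩
      exact ⟨s, hs.1, l, hl, hel⟩

end PathSystem

theorem pathInput_congr {N : ℕ} {T : Type*} {EH : Finset (Fin N × Fin N)} {L : ℕ}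
    {p p' : T → ℕ → Fin N} {A A' : Set T} (hA : A = A') (hp : ∀ s ∈ A, p s = p' s) :
    pathInput EH L p A = pathInput EH L p' A' := by
  subst hA
  funext e
  simp only [pathInput]
  congr 1
  refine propext (exists_congr fun s => and_congr_right fun hs => ?_)
  rw [hp s hs]

/-- A bounded-congestion routing scheme `p` between terminals, inside the host graph `EH`, yields
a critical input with many disjoint sensitive blocks. -/
theorem exists_qCritical_many_blocks {N L : ℕ} {EH : Finset (Fin N × Fin N)} {T R : Type*}
    [Fintype T] [DecidableEq T] [Fintype R] {v₀ : T} {vt : T → Fin N}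
    {p : T → R → T → ℕ → Fin N} (hL : 0 < L)
    (hE : ∀ s r t, ∀ l < L, (p s r t l, p s r t (l + 1)) ∈ EH)
    (hvt : Function.Injective vt)
    (hp0 : ∀ s r t, p s r t 0 = vt s) (hpL : ∀ s r t, p s r t L = vt t)
    (hint : ∀ s r t u l, 0 < l → l < L → p s r t l ≠ vt u)
    (hlev : ∀ s r t s' r' t' l l', l < L → l' < L → p s r t l = p s' r' t' l' → l = l')
    (hblock : ∀ (π : Equiv.Perm T) (ρ : T → R) (b : T),
      4 * Nat.card {r : R // ∃ s, s ≠ b ∧ ∃ l ≤ L, p b r (π b) l = p s (ρ s) (π s) l}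
        ≤ Fintype.card R)
    (hex : ∃ ρ : T → R, ∀ s s' l, l ≤ L → p s (ρ s) s l = p s' (ρ s') s' l → s = s')
    (f : ({e // e ∈ EH} → Bool) → Fin N) (hf : ∀ x, QSolution EH (vt v₀) x (f x)) :
    ∃ x : {e // e ∈ EH} → Bool, QCritical EH (vt v₀) x ∧
      ∃ (b : ℕ) (B : Fin b → Finset {e // e ∈ EH}),
        Fintype.card T ≤ 4 * b + 1 ∧
        (∀ i j, i ≠ j → Disjoint (B i) (B j)) ∧
        (∀ i, f (flipBits EH x (B i)) ≠ f x) := by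
  classical
  obtain ⟨π, ρ, hval, hcard⟩ := exists_routing_many_sensitive v₀
    (fun q q' => ∃ l ≤ L, p q.1 q.2.1 q.2.2 l = p q'.1 q'.2.1 q'.2.2 l)
    (fun q q' ⟨l, hl, h⟩ => ⟨l, hl, h.symm⟩) hblock
    (by
      obtain ⟨ρ, hρ⟩ := hex
      exact ⟨1, ρ, fun s s' hs ⟨l, hl, h⟩ => hs (hρ s s' l hl h)⟩)
    (fun π ρ b => f (pathInput EH L (fun s => p s (ρ s) (π s))
      ({s | s ≠ π.symm v₀} \ {b})) ≠ vt (π.symm v₀))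
    (by
      intro π ρ b hb
      by_contra! hcon
      obtain ⟨h1, h2⟩ := hcon
      have hd : (π * Equiv.swap b (π.symm v₀)).symm v₀ = b := by
        simp [Equiv.symm_apply_eq]
      rw [hd] at h2
      refine hb (hvt ?_)
      rw [← h1, ← h2]
      congr 1
      refine pathInput_congr ?_ ?_
      · ext s
        simp [and_comm]
      · intro s hs
        simp only [Set.mem_sdiff, Set.mem_ofPred_eq, Set.mem_singleton_iff] at hs
        simp [Equiv.swap_apply_of_ne_of_ne hs.1 hs.2])
  set d := π.symm v₀ with hd
  set q : T → ℕ → Fin N := fun s => p s (ρ s) (π s) with hq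
  have hinj : ∀ s s' l, s ≠ d → s' ≠ d → l ≤ L → q s l = q s' l → s = s' := by
    intro s s' l hs hs' hl h
    by_contra hne
    exact hval s s' hs hs' hne ⟨l, hl, h⟩
  have hsol := qSolution_pathInput_iff (EH := EH) (p := q) (π := π) (v₀ := v₀) (vt := vt) hL
    (fun s => hE s _ _) hvt (fun s => hp0 _ _ _) (fun s => hpL _ _ _)
    (fun s => hint s _ _) (fun s s' => hlev _ _ _ _ _ _) hinj
  rw [← hd] at hsol
  set x := pathInput EH L q {s | s ≠ d} with hx
  have hfx : f x = vt d := (hsol _).1 (hf x)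
  have htail : ∀ s ∈ {s | s ≠ d}, ∀ s' ∈ {s | s ≠ d}, ∀ l < L, ∀ l' < L,
      q s l = q s' l' → s = s' := by
    intro s hs s' hs' l hl l' hl' h
    obtain rfl := hlev _ _ _ _ _ _ _ _ hl hl' h
    exact hinj _ _ _ hs hs' hl.le h
  let S := {b : T // b ≠ d ∧ f (pathInput EH L q ({s | s ≠ d} \ {b})) ≠ vt d}
  let g : Fin (Nat.card S) ≃ S := (Finite.equivFin S).symm
  refine ⟨x, ⟨vt d, (hsol _).2 rfl, fun v hv => (hsol v).1 hv⟩, Nat.card S,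
    fun i => pathBlock EH L q (g i).1, hcard, ?_, ?_⟩
  · intro i j hij
    refine disjoint_pathBlock htail (g i).2.1 (g j).2.1 ?_
    intro h
    exact hij (g.injective (Subtype.ext h))
  · intro i
    rw [hx, flipBits_pathInput_pathBlock htail (g i).2.1, ← hx, hfx]
    exact (g i).2.2

/-- The word whose low `i` bits are those of `r` and whose remaining bits are those of `s`. -/
def mixWord (i s r : ℕ) : ℕ := 2 ^ i * (s / 2 ^ i) + r % 2 ^ i

theorem mixWord_div (i s r : ℕ) : mixWord i s r / 2 ^ i = s / 2 ^ i := by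
  rw [mixWord, Nat.mul_add_div (by positivity),
    Nat.div_eq_of_lt (Nat.mod_lt _ (by positivity)), add_zero]

theorem mixWord_mod (i s r : ℕ) : mixWord i s r % 2 ^ i = r % 2 ^ i := by
  rw [mixWord, Nat.mul_add_mod, Nat.mod_mod]

theorem mixWord_self (i s : ℕ) : mixWord i s s = s := Nat.div_add_mod s (2 ^ i)

theorem mixWord_zero (s r : ℕ) : mixWord 0 s r = s := by
  simp [mixWord, Nat.mod_one]

theorem mixWord_lt {k i s r : ℕ} (hi : i ≤ k) (hs : s < 2 ^ k) : mixWord i s r < 2 ^ k := by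
  have h : (2 : ℕ) ^ k = 2 ^ (k - i) * 2 ^ i := by rw [← pow_add, Nat.sub_add_cancel hi]
  rw [h, ← Nat.div_lt_iff_lt_mul (by positivity), mixWord_div,
    Nat.div_lt_iff_lt_mul (by positivity), ← h]
  exact hs

theorem mixWord_div_succ (i s r : ℕ) :
    mixWord i s r / 2 ^ (i + 1) = mixWord (i + 1) s r / 2 ^ (i + 1) := by
  rw [mixWord_div, pow_succ, ← Nat.div_div_eq_div_mul, mixWord_div, Nat.div_div_eq_div_mul]

theorem mixWord_succ_mod (i s r : ℕ) : mixWord i s r % 2 ^ i = mixWord (i + 1) s r % 2 ^ i := by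
  rw [mixWord_mod, ← Nat.mod_mod_of_dvd (mixWord (i + 1) s r) (pow_dvd_pow 2 (Nat.le_succ i)),
    mixWord_mod, Nat.mod_mod_of_dvd _ (pow_dvd_pow 2 (Nat.le_succ i))]

/-- The word at level `l` of the route from `s` through `r` to `t` in a butterfly of dimension `k`
followed by its mirror image. -/
def routeWord (k s r t l : ℕ) : ℕ := if l ≤ k then mixWord l s r else mixWord (2 * k - l) t r

theorem routeWord_of_le {k s r t l : ℕ} (h : l ≤ k) : routeWord k s r t l = mixWord l s r :=
  if_pos h

theorem routeWord_of_ge {k s r t l : ℕ} (hs : s < 2 ^ k) (ht : t < 2 ^ k) (h : k ≤ l) :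
    routeWord k s r t l = mixWord (2 * k - l) t r := by
  rcases h.eq_or_lt with rfl | h
  · rw [routeWord, if_pos le_rfl, show 2 * k - k = k by omega, mixWord, mixWord,
      Nat.div_eq_of_lt hs, Nat.div_eq_of_lt ht]
  · exact if_neg (by omega)

theorem routeWord_lt {k s r t l : ℕ} (hs : s < 2 ^ k) (ht : t < 2 ^ k) :
    routeWord k s r t l < 2 ^ k := by
  rw [routeWord]
  split_ifs with h
  · exact mixWord_lt h hs
  · exact mixWord_lt (by omega) ht

/-- The bit that may change between levels `l` and `l + 1`. -/
def bitIndex (k l : ℕ) : ℕ := if l < k then l else 2 * k - 1 - l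

theorem routeWord_step {k s r t l : ℕ} (hs : s < 2 ^ k) (ht : t < 2 ^ k) (hl : l < 2 * k) :
    routeWord k s r t l / 2 ^ (bitIndex k l + 1) =
        routeWord k s r t (l + 1) / 2 ^ (bitIndex k l + 1) ∧
      routeWord k s r t l % 2 ^ bitIndex k l = routeWord k s r t (l + 1) % 2 ^ bitIndex k l := by
  rcases Nat.lt_or_ge l k with h | h
  · rw [bitIndex, if_pos h, routeWord_of_le h.le, routeWord_of_le h]
    exact ⟨mixWord_div_succ _ _ _, mixWord_succ_mod _ _ _⟩
  · rw [bitIndex, if_neg (by omega), routeWord_of_ge hs ht h, routeWord_of_ge hs ht (by omega),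
      show 2 * k - l = 2 * k - 1 - l + 1 by omega, show 2 * k - (l + 1) = 2 * k - 1 - l by omega]
    exact ⟨(mixWord_div_succ _ _ _).symm, (mixWord_succ_mod _ _ _).symm⟩

theorem eq_of_div_mod_bit {i w w' : ℕ} (h1 : w / 2 ^ (i + 1) = w' / 2 ^ (i + 1))
    (h2 : w % 2 ^ i = w' % 2 ^ i) (h3 : w / 2 ^ i % 2 = w' / 2 ^ i % 2) : w = w' := by
  rw [pow_succ, ← Nat.div_div_eq_div_mul, ← Nat.div_div_eq_div_mul] at h1
  have h4 : w / 2 ^ i = w' / 2 ^ i := by omega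
  rw [← Nat.div_add_mod w (2 ^ i), ← Nat.div_add_mod w' (2 ^ i), h4, h2]

/-- Adjacency in the cyclic double butterfly: the vertex at level `l < 2 * k` with word
`w < 2 ^ k` is encoded as `l * 2 ^ k + w`. -/
def butterflyAdj (k u v : ℕ) : Prop :=
  u / 2 ^ k < 2 * k ∧ v / 2 ^ k = (u / 2 ^ k + 1) % (2 * k) ∧
    u % 2 ^ k / 2 ^ (bitIndex k (u / 2 ^ k) + 1) = v % 2 ^ k / 2 ^ (bitIndex k (u / 2 ^ k) + 1) ∧
    u % 2 ^ k % 2 ^ bitIndex k (u / 2 ^ k) = v % 2 ^ k % 2 ^ bitIndex k (u / 2 ^ k)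

theorem butterflyAdj_left_unique {k u u' v : ℕ} (h : butterflyAdj k u v)
    (h' : butterflyAdj k u' v)
    (hbit : u % 2 ^ k / 2 ^ bitIndex k (u / 2 ^ k) % 2 =
      u' % 2 ^ k / 2 ^ bitIndex k (u' / 2 ^ k) % 2) : u = u' := by
  obtain ⟨a1, a2, a3, a4⟩ := h
  obtain ⟨b1, b2, b3, b4⟩ := h'
  have hl : u / 2 ^ k = u' / 2 ^ k := by
    rw [a2] at b2
    generalize u / 2 ^ k = a at *
    generalize u' / 2 ^ k = b at *
    rcases Nat.lt_or_ge (a + 1) (2 * k) with h | h <;>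
    rcases Nat.lt_or_ge (b + 1) (2 * k) with h' | h'
    · rw [Nat.mod_eq_of_lt h, Nat.mod_eq_of_lt h'] at b2
      omega
    · rw [Nat.mod_eq_of_lt h, show b + 1 = 2 * k by omega, Nat.mod_self] at b2
      omega
    · rw [Nat.mod_eq_of_lt h', show a + 1 = 2 * k by omega, Nat.mod_self] at b2
      omega
    · omega
  rw [← hl] at b3 b4 hbit
  rw [← Nat.div_add_mod u (2 ^ k), ← Nat.div_add_mod u' (2 ^ k), hl,
    eq_of_div_mod_bit (a3.trans b3.symm) (a4.trans b4.symm) hbit]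

theorem butterflyAdj_right_unique {k u v v' : ℕ} (h : butterflyAdj k u v)
    (h' : butterflyAdj k u v')
    (hbit : v % 2 ^ k / 2 ^ bitIndex k (u / 2 ^ k) % 2 =
      v' % 2 ^ k / 2 ^ bitIndex k (u / 2 ^ k) % 2) : v = v' := by
  obtain ⟨a1, a2, a3, a4⟩ := h
  obtain ⟨b1, b2, b3, b4⟩ := h'
  rw [← Nat.div_add_mod v (2 ^ k), ← Nat.div_add_mod v' (2 ^ k), a2, b2,
    eq_of_div_mod_bit (a3.symm.trans b3) (a4.symm.trans b4) hbit]

open Classical in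
/-- The cyclic double butterfly of dimension `k` on the vertex set `Fin N`. -/
noncomputable def butterfly (N k : ℕ) : Finset (Fin N × Fin N) :=
  Finset.univ.filter fun e => butterflyAdj k e.1 e.2

theorem card_butterfly_in_le (N k : ℕ) (v : Fin N) :
    ((butterfly N k).filter (fun e => e.2 = v)).card ≤ 2 := by
  rw [← Finset.card_range 2]
  refine Finset.card_le_card_of_injOn
    (fun e => e.1.1 % 2 ^ k / 2 ^ bitIndex k (e.1.1 / 2 ^ k) % 2) ?_ ?_
  · intro e _
    simpa using Nat.mod_lt _ two_pos
  · rintro ⟨u, w⟩ h ⟨u', w'⟩ h' hbit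
    simp only [butterfly, Finset.mem_coe, Finset.mem_filter, Finset.mem_univ, true_and] at h h'
    obtain ⟨h, rfl⟩ := h
    obtain ⟨h', rfl⟩ := h'
    rw [Fin.ext (butterflyAdj_left_unique h h' hbit)]

theorem card_butterfly_out_le (N k : ℕ) (v : Fin N) :
    ((butterfly N k).filter (fun e => e.1 = v)).card ≤ 2 := by
  rw [← Finset.card_range 2]
  refine Finset.card_le_card_of_injOn
    (fun e => e.2.1 % 2 ^ k / 2 ^ bitIndex k (e.1.1 / 2 ^ k) % 2) ?_ ?_
  · intro e _
    simpa using Nat.mod_lt _ two_pos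
  · rintro ⟨u, w⟩ h ⟨u', w'⟩ h' hbit
    simp only [butterfly, Finset.mem_coe, Finset.mem_filter, Finset.mem_univ, true_and] at h h'
    obtain ⟨h, rfl⟩ := h
    obtain ⟨h', rfl⟩ := h'
    rw [Fin.ext (butterflyAdj_right_unique h h' hbit)]

theorem card_mod_eq_le {k i : ℕ} (hi : i ≤ k) (c : ℕ) :
    ((Finset.univ : Finset (Fin (2 ^ k))).filter fun r => r.1 % 2 ^ i = c).card ≤ 2 ^ (k - i) := by
  rw [← Finset.card_range (2 ^ (k - i))]
  refine Finset.card_le_card_of_injOn (fun r => r.1 / 2 ^ i) ?_ ?_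
  · intro r _
    simp only [Finset.coe_range, Set.mem_Iio]
    rw [Nat.div_lt_iff_lt_mul (by positivity), ← pow_add, Nat.sub_add_cancel hi]
    exact r.2
  · intro r hr r' hr' h
    simp only [Finset.mem_coe, Finset.mem_filter, Finset.mem_univ, true_and] at hr hr' h
    apply Fin.ext
    rw [← Nat.div_add_mod r.1 (2 ^ i), ← Nat.div_add_mod r'.1 (2 ^ i), h, hr, hr']

theorem card_div_eq_le {m i : ℕ} {g : Fin (2 ^ m) → Fin (2 ^ m)} (hg : Function.Injective g)
    (c : ℕ) :
    ((Finset.univ : Finset (Fin (2 ^ m))).filter fun a => (g a).1 / 2 ^ i = c).card ≤ 2 ^ i := by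
  refine (Finset.card_le_card_of_injOn (t := Finset.range (2 ^ i))
    (fun a => (g a).1 % 2 ^ i) ?_ ?_).trans_eq (Finset.card_range _)
  · intro a _
    simpa using Nat.mod_lt _ (by positivity)
  · intro a ha a' ha' h
    simp only [Finset.mem_coe, Finset.mem_filter, Finset.mem_univ, true_and] at ha ha' h
    apply hg
    apply Fin.ext
    rw [← Nat.div_add_mod (g a).1 (2 ^ i), ← Nat.div_add_mod (g a').1 (2 ^ i), h, ha, ha']

theorem mixWord_conflict {j i a a' r r' : ℕ} (hne : a ≠ a')
    (h : mixWord i (2 ^ j * a) r = mixWord i (2 ^ j * a') r') :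
    j < i ∧ a / 2 ^ (i - j) = a' / 2 ^ (i - j) ∧ r % 2 ^ i = r' % 2 ^ i := by
  have h1 : 2 ^ j * a / 2 ^ i = 2 ^ j * a' / 2 ^ i := by
    rw [← mixWord_div i _ r, h, mixWord_div]
  have h2 : r % 2 ^ i = r' % 2 ^ i := by rw [← mixWord_mod i (2 ^ j * a), h, mixWord_mod]
  rcases Nat.lt_or_ge j i with hji | hji
  · refine ⟨hji, ?_, h2⟩
    obtain ⟨q, rfl⟩ := Nat.exists_eq_add_of_lt hji
    rw [show j + q + 1 - j = q + 1 by omega]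
    rwa [add_assoc, pow_add, Nat.mul_div_mul_left _ _ (by positivity),
      Nat.mul_div_mul_left _ _ (by positivity)] at h1
  · refine absurd ?_ hne
    obtain ⟨q, rfl⟩ := Nat.exists_eq_add_of_le hji
    rw [pow_add, mul_assoc, mul_assoc, Nat.mul_div_cancel_left _ (by positivity),
      Nat.mul_div_cancel_left _ (by positivity)] at h1
    exact Nat.eq_of_mul_eq_mul_left (by positivity) h1

/-- Few of the routes of the link `b → π b` meet the routes of the other links. -/
theorem card_conflicting_routes_le {j m : ℕ} (hjm : 8 * m ≤ 2 ^ j)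
    (π : Equiv.Perm (Fin (2 ^ m))) (ρ : Fin (2 ^ m) → Fin (2 ^ (m + j))) (b : Fin (2 ^ m)) :
    4 * Nat.card {r : Fin (2 ^ (m + j)) // ∃ s, s ≠ b ∧ ∃ l ≤ 2 * (m + j),
      routeWord (m + j) (2 ^ j * b) r (2 ^ j * π b) l =
        routeWord (m + j) (2 ^ j * s) (ρ s) (2 ^ j * π s) l} ≤ 2 ^ (m + j) := by
  classical
  rw [Nat.card_eq_fintype_card, Fintype.card_subtype]
  let U (g : Fin (2 ^ m) → Fin (2 ^ m)) : Finset (Fin (2 ^ (m + j))) :=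
    (Finset.Icc 1 m).biUnion fun q =>
      (Finset.univ.filter fun s => (g s).1 / 2 ^ q = (g b).1 / 2 ^ q).biUnion fun s =>
        Finset.univ.filter fun r => r.1 % 2 ^ (j + q) = (ρ s).1 % 2 ^ (j + q)
  have hU : ∀ g, Function.Injective g → (U g).card ≤ m * 2 ^ m := by
    intro g hg
    have h : (U g).card ≤ (Finset.Icc 1 m).card * 2 ^ m := by
      refine Finset.card_biUnion_le_card_mul _ _ _ ?_
      intro q hq
      rw [Finset.mem_Icc] at hq
      refine (Finset.card_biUnion_le_card_mul _ _ (2 ^ (m - q)) ?_).trans ?_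
      · intro s _
        have := card_mod_eq_le (k := m + j) (i := j + q) (by omega) ((ρ s).1 % 2 ^ (j + q))
        rwa [show m + j - (j + q) = m - q by omega] at this
      · calc _ ≤ 2 ^ q * 2 ^ (m - q) := Nat.mul_le_mul_right _ (card_div_eq_le hg _)
          _ = 2 ^ m := by rw [← pow_add, Nat.add_sub_cancel' hq.2]
    simpa using h
  have hmem : ∀ (g : Fin (2 ^ m) → Fin (2 ^ m)) (s : Fin (2 ^ m)) (r : Fin (2 ^ (m + j))) (i : ℕ),
      g b ≠ g s → i ≤ m + j →
      mixWord i (2 ^ j * g b) r = mixWord i (2 ^ j * g s) (ρ s) → r ∈ U g := by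
    intro g s r i hne hi h
    obtain ⟨h1, h2, h3⟩ := mixWord_conflict (fun e => hne (Fin.ext e)) h
    simp only [U, Finset.mem_biUnion, Finset.mem_filter, Finset.mem_univ, true_and, Finset.mem_Icc]
    refine ⟨i - j, by omega, s, h2.symm, ?_⟩
    rwa [Nat.add_sub_cancel' h1.le]
  have hlt : ∀ a : Fin (2 ^ m), 2 ^ j * a.1 < 2 ^ (m + j) := by
    intro a
    rw [add_comm, pow_add]
    exact Nat.mul_lt_mul_of_pos_left a.2 (by positivity)
  have hsub : (Finset.univ.filter fun r : Fin (2 ^ (m + j)) => ∃ s, s ≠ b ∧ ∃ l ≤ 2 * (m + j),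
      routeWord (m + j) (2 ^ j * b) r (2 ^ j * π b) l =
        routeWord (m + j) (2 ^ j * s) (ρ s) (2 ^ j * π s) l) ⊆ U id ∪ U π := by
    intro r hr
    simp only [Finset.mem_filter, Finset.mem_univ, true_and] at hr
    obtain ⟨s, hs, l, hl, h⟩ := hr
    rw [Finset.mem_union]
    rcases Nat.le_or_ge l (m + j) with hlk | hlk
    · rw [routeWord_of_le hlk, routeWord_of_le hlk] at h
      exact Or.inl (hmem id s r l hs.symm hlk h)
    · rw [routeWord_of_ge (hlt _) (hlt _) hlk, routeWord_of_ge (hlt _) (hlt _) hlk] at h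
      exact Or.inr (hmem π s r _ (fun e => hs (π.injective e).symm) (by omega) h)
  have h1 := (Finset.card_le_card hsub).trans (Finset.card_union_le _ _)
  have h2 := hU id Function.injective_id
  have h3 := hU π π.injective
  calc _ ≤ 4 * (m * 2 ^ m + m * 2 ^ m) := by omega
    _ = (8 * m) * 2 ^ m := by ring
    _ ≤ 2 ^ j * 2 ^ m := Nat.mul_le_mul_right _ hjm
    _ = 2 ^ (m + j) := by rw [← pow_add, add_comm]

/-- Critical block sensitivity of the double butterfly with terminals `2 ^ j * a`, `a < 2 ^ m`. -/
theorem butterfly_critical_block_sensitivity {N m j : ℕ} (hm : 0 < m) (hjm : 8 * m ≤ 2 ^ j)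
    (hN : 2 * (m + j) * 2 ^ (m + j) ≤ N) :
    ∃ v₀ : Fin N, ∀ f : ({e // e ∈ butterfly N (m + j)} → Bool) → Fin N,
      (∀ x, QSolution (butterfly N (m + j)) v₀ x (f x)) →
      ∃ x, QCritical (butterfly N (m + j)) v₀ x ∧
        ∃ (b : ℕ) (B : Fin b → Finset {e // e ∈ butterfly N (m + j)}),
          2 ^ m ≤ 4 * b + 1 ∧
          (∀ i i', i ≠ i' → Disjoint (B i) (B i')) ∧
          (∀ i, f (flipBits (butterfly N (m + j)) x (B i)) ≠ f x) := by
  set k := m + j with hk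
  have hkpos : 0 < 2 * k := by omega
  have hlt : ∀ a : Fin (2 ^ m), 2 ^ j * a.1 < 2 ^ k := by
    intro a
    rw [hk, add_comm m, pow_add]
    exact Nat.mul_lt_mul_of_pos_left a.2 (by positivity)
  have hcode : ∀ l w, w < 2 ^ k → l % (2 * k) * 2 ^ k + w < N := by
    intro l w hw
    refine lt_of_lt_of_le ?_ hN
    calc _ < l % (2 * k) * 2 ^ k + 2 ^ k := by omega
      _ = (l % (2 * k) + 1) * 2 ^ k := by ring
      _ ≤ _ := Nat.mul_le_mul_right _ (Nat.mod_lt _ hkpos)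
  have hdiv : ∀ l w, w < 2 ^ k → (l % (2 * k) * 2 ^ k + w) / 2 ^ k = l % (2 * k) := by
    intro l w hw
    rw [mul_comm, Nat.mul_add_div (by positivity), Nat.div_eq_of_lt hw, add_zero]
  have hmod : ∀ l w, w < 2 ^ k → (l % (2 * k) * 2 ^ k + w) % 2 ^ k = w := by
    intro l w hw
    rw [mul_comm, Nat.mul_add_mod, Nat.mod_eq_of_lt hw]
  let p : Fin (2 ^ m) → Fin (2 ^ k) → Fin (2 ^ m) → ℕ → Fin N := fun s r t l =>
    ⟨_, hcode l _ (routeWord_lt (k := k) (r := r.1) (l := l) (hlt s) (hlt t))⟩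
  let vt : Fin (2 ^ m) → Fin N := fun s => ⟨_, hcode 0 _ (hlt s)⟩
  have hpword : ∀ s r t s' r' t' l l', p s r t l = p s' r' t' l' →
      l % (2 * k) = l' % (2 * k) ∧ routeWord k (2 ^ j * s) r (2 ^ j * t) l =
        routeWord k (2 ^ j * s') r' (2 ^ j * t') l' := by
    intro s r t s' r' t' l l' h
    have h := congrArg Fin.val h
    have h1 := congrArg (· / 2 ^ k) h
    have h2 := congrArg (· % 2 ^ k) h
    simp only [p] at h1 h2
    rw [hdiv _ _ (routeWord_lt (hlt _) (hlt _)), hdiv _ _ (routeWord_lt (hlt _) (hlt _))] at h1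
    rw [hmod _ _ (routeWord_lt (hlt _) (hlt _)), hmod _ _ (routeWord_lt (hlt _) (hlt _))] at h2
    exact ⟨h1, h2⟩
  have hvt : ∀ s s', vt s = vt s' → s = s' := by
    intro s s' h
    have h := congrArg Fin.val h
    simp only [vt, Nat.zero_mod, zero_mul, zero_add] at h
    exact Fin.ext (Nat.eq_of_mul_eq_mul_left (by positivity) h)
  have hp0 : ∀ s r t, p s r t 0 = vt s := by
    intro s r t
    apply Fin.ext
    simp [p, vt, routeWord_of_le, mixWord_zero]
  have hpL : ∀ s r t, p s r t (2 * k) = vt t := by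
    intro s r t
    apply Fin.ext
    simp only [p, vt, Nat.mod_self, Nat.zero_mod]
    rw [routeWord_of_ge (hlt s) (hlt t) (by omega), Nat.sub_self, mixWord_zero]
  have hlev : ∀ s r t s' r' t' l l', l < 2 * k → l' < 2 * k →
      p s r t l = p s' r' t' l' → l = l' := by
    intro s r t s' r' t' l l' hl hl' h
    have := (hpword _ _ _ _ _ _ _ _ h).1
    rwa [Nat.mod_eq_of_lt hl, Nat.mod_eq_of_lt hl'] at this
  have hE : ∀ s r t, ∀ l < 2 * k, (p s r t l, p s r t (l + 1)) ∈ butterfly N k := by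
    intro s r t l hl
    simp only [butterfly, Finset.mem_filter, Finset.mem_univ, true_and]
    simp only [butterflyAdj, p]
    rw [hdiv _ _ (routeWord_lt (hlt _) (hlt _)), hdiv _ _ (routeWord_lt (hlt _) (hlt _)),
      hmod _ _ (routeWord_lt (hlt _) (hlt _)), hmod _ _ (routeWord_lt (hlt _) (hlt _)),
      Nat.mod_eq_of_lt hl]
    exact ⟨hl, rfl, routeWord_step (hlt _) (hlt _) hl⟩
  refine ⟨vt ⟨0, by positivity⟩, fun f hf => ?_⟩
  have := exists_qCritical_many_blocks (p := p) (vt := vt) hkpos hE hvt hp0 hpL ?_ hlev ?_ ?_ f hf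
  · simpa using this
  · intro s r t u l hl0 hl h
    rw [← hp0 u r u] at h
    have := hlev _ _ _ _ _ _ _ _ hl hkpos h
    omega
  · intro π ρ b
    have := card_conflicting_routes_le hjm π ρ b
    rw [Fintype.card_fin]
    refine le_trans (Nat.mul_le_mul_left 4 ?_) this
    refine Nat.card_le_card_of_injective
      (Subtype.map id ?_) (Subtype.map_injective _ Function.injective_id)
    rintro r ⟨s, hs, l, hl, h⟩
    exact ⟨s, hs, l, hl, (hpword _ _ _ _ _ _ _ _ h).2⟩
  · refine ⟨fun s => ⟨2 ^ j * s, hlt s⟩, ?_⟩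
    intro s s' l hl h
    have h := (hpword _ _ _ _ _ _ _ _ h).2
    have hroute : ∀ a : ℕ, routeWord k a a a l = a := by
      intro a
      rw [routeWord, mixWord_self, mixWord_self, ite_self]
    rw [hroute, hroute] at h
    exact Fin.ext (Nat.eq_of_mul_eq_mul_left (by positivity) h)

/-- The dimension of a double butterfly with `2 ^ m` sufficiently spread out terminals. -/
def butterflyDim (m : ℕ) : ℕ := m + Nat.clog 2 (8 * m)

theorem butterflyDim_size_le {m : ℕ} (hm : 0 < m) :
    2 * butterflyDim m * 2 ^ butterflyDim m ≤ 544 * m ^ 2 * 2 ^ m := by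
  have h1 := Nat.pow_pred_clog_lt_self (b := 2) (by norm_num) (x := 8 * m) (by omega)
  have h2 : 0 < Nat.clog 2 (8 * m) := Nat.clog_pos (by norm_num) (by omega)
  have h3 : 2 ^ Nat.clog 2 (8 * m) ≤ 16 * m := by
    rw [← Nat.succ_pred_eq_of_pos h2, pow_succ]
    omega
  have h4 : Nat.clog 2 (8 * m) < 2 ^ Nat.clog 2 (8 * m) := Nat.lt_two_pow_self
  rw [butterflyDim, pow_add]
  calc _ ≤ 2 * (17 * m) * (2 ^ m * (16 * m)) := by gcongr; omega
    _ = _ := by ring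

theorem exists_butterflyDim {N : ℕ} (hN : 2 * butterflyDim 3 * 2 ^ butterflyDim 3 ≤ N) :
    ∃ m, 3 ≤ m ∧ 2 * butterflyDim m * 2 ^ butterflyDim m ≤ N ∧
      N < 2 * butterflyDim (m + 1) * 2 ^ butterflyDim (m + 1) := by
  by_contra! hcon
  have h : ∀ m, 3 ≤ m → 2 * butterflyDim m * 2 ^ butterflyDim m ≤ N := by
    intro m hm
    induction m, hm using Nat.le_induction with
    | base => exact hN
    | succ m hm ih => exact hcon m hm ih
  have h1 := h (N + 3) (by omega)
  have h2 : N + 3 ≤ butterflyDim (N + 3) := Nat.le_add_right _ _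
  have h3 : 1 ≤ 2 ^ butterflyDim (N + 3) := Nat.one_le_two_pow
  nlinarith

theorem stmt1 :
    ∃ (d : ℕ) (c C : ℝ), 0 < c ∧ 0 < C ∧
      ∃ N₀ : ℕ, ∀ N : ℕ, N₀ ≤ N →
        ∃ (EH : Finset (Fin N × Fin N)) (v₀ : Fin N),
          -- every vertex of `H` has in-degree at most `d` and out-degree at most `d`
          (∀ v : Fin N, (EH.filter (fun e => e.2 = v)).card ≤ d ∧
                        (EH.filter (fun e => e.1 = v)).card ≤ d) ∧
          -- critical block sensitivity lower bound
          (∀ f : ({e // e ∈ EH} → Bool) → Fin N,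
            (∀ x, QSolution EH v₀ x (f x)) →
            ∃ x : {e // e ∈ EH} → Bool, QCritical EH v₀ x ∧
              ∃ (b : ℕ) (B : Fin b → Finset {e // e ∈ EH}),
                c * N / (Real.log N) ^ C ≤ (b : ℝ) ∧
                (∀ i j, i ≠ j → Disjoint (B i) (B j)) ∧
                (∀ i, f (flipBits EH x (B i)) ≠ f x)) := by
  refine ⟨2, 1 / 139264, 2, by norm_num, by norm_num,
    2 * butterflyDim 3 * 2 ^ butterflyDim 3, fun N hN => ?_⟩
  obtain ⟨m, hm, hle, hlt⟩ := exists_butterflyDim hN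
  obtain ⟨v₀, h⟩ := butterfly_critical_block_sensitivity (N := N) (m := m)
    (by omega) (Nat.le_pow_clog (b := 2) (by norm_num) (8 * m)) hle
  refine ⟨butterfly N (butterflyDim m), v₀,
    fun v => ⟨card_butterfly_in_le _ _ v, card_butterfly_out_le _ _ v⟩, fun f hf => ?_⟩
  obtain ⟨x, hx, b, B, hb, hB⟩ := h f hf
  refine ⟨x, hx, b, B, ?_, hB⟩
  have h8 : 2 ^ 3 ≤ 2 ^ m := Nat.pow_le_pow_right (by norm_num) hm
  have hb8 : 2 ^ m ≤ 8 * b := by omega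
  have hNb : N ≤ 34816 * m ^ 2 * b := by
    calc N ≤ 544 * (m + 1) ^ 2 * 2 ^ (m + 1) := hlt.le.trans (butterflyDim_size_le (by omega))
      _ ≤ 544 * (2 * m) ^ 2 * 2 ^ (m + 1) := by gcongr; omega
      _ = 4352 * m ^ 2 * 2 ^ m := by ring
      _ ≤ 4352 * m ^ 2 * (8 * b) := Nat.mul_le_mul_left _ hb8
      _ = _ := by ring
  have hmN : 2 ^ m ≤ N := by
    refine le_trans ?_ hle
    have h1 : m ≤ butterflyDim m := Nat.le_add_right _ _
    have h2 : 2 ^ m ≤ 2 ^ butterflyDim m := Nat.pow_le_pow_right (by norm_num) h1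
    exact h2.trans (Nat.le_mul_of_pos_left _ (by omega))
  have hlog : (m : ℝ) / 2 ≤ Real.log N := by
    have h1 : Real.log ((2 : ℝ) ^ m) ≤ Real.log N :=
      Real.log_le_log (by positivity) (by exact_mod_cast hmN)
    rw [Real.log_pow] at h1
    have h2 := Real.log_two_gt_d9
    have h3 : (0 : ℝ) ≤ m := Nat.cast_nonneg m
    nlinarith
  have hm0 : (0 : ℝ) < m := by exact_mod_cast (by omega : 0 < m)
  have hsq : ((m : ℝ) / 2) ^ 2 ≤ Real.log N ^ 2 := by gcongr
  have hNb' : (N : ℝ) ≤ 34816 * (m : ℝ) ^ 2 * b := by exact_mod_cast hNb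
  have hpos : (0 : ℝ) < Real.log N ^ 2 := lt_of_lt_of_le (by positivity) hsq
  rw [Real.rpow_two, div_le_iff₀ hpos]
  have hb0 : (0 : ℝ) ≤ b := Nat.cast_nonneg b
  have := mul_le_mul_of_nonneg_left hsq hb0
  linarith
end

section
/- For every Δ ∈ ℕ and every ε > 0 there exists n₀ such that for all n ≥ n₀ and every digraph G on vertex set {0,1}^n in which every vertex has in-degree at most Δ and out-degree at most Δ, if one samples independently for each edge e = (v,u) of G a path p_e ∼ P_{(v,u)} (a uniformly random directed path of length 2n from (v,0) to (u,0) in the double butterfly graph H), then with probability at least 1 − ε every vertex of H has congestion at most ε·n. -/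
/-!
STATEMENT 3: Oblivious routing in the double butterfly graph has low
congestion with high probability.
-/

/-- Vertices of the double butterfly graph: a boolean string together with a
layer, counted cyclically modulo `2n`. -/
abbrev BV (n : ℕ) := (Fin n → Bool) × ZMod (2 * n)

/-- Flip the `j`-th coordinate of a boolean string. -/
def flipCoord {n : ℕ} (z : Fin n → Bool) (j : ℕ) : Fin n → Bool :=
  fun i => if (i : ℕ) = j then !(z i) else z i

/-- Adjacency in the double butterfly graph: `(z, i)` has edges to `(z, i+1)`
and to `(z ⊕ e_{(i mod n)+1}, i+1)`. -/
def HAdj {n : ℕ} (a b : BV n) : Prop :=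
  b.2 = a.2 + 1 ∧ (b.1 = a.1 ∨ b.1 = flipCoord a.1 (a.2.val % n))

/-- `p` is a directed path of length `2n` in the double butterfly graph from
the layer-0 vertex `(v, 0)` to the layer-0 vertex `(u, 0)`. -/
def IsBPath {n : ℕ} (v u : Fin n → Bool) (p : Fin (2 * n + 1) → BV n) : Prop :=
  p 0 = (v, 0) ∧ p (Fin.last (2 * n)) = (u, 0) ∧
  ∀ i : Fin (2 * n), HAdj (p i.castSucc) (p i.succ)

/-- A tuple assigning to each edge `e = (v,u)` of the digraph `G` a directed
path of length `2n` from `(v,0)` to `(u,0)` in the double butterfly graph.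
The uniform probability distribution on this (finite) type corresponds to
sampling, independently for each edge `e`, a path `p_e ∼ P_e` uniformly. -/
abbrev PathTuple {n : ℕ} (G : Finset ((Fin n → Bool) × (Fin n → Bool))) :=
  ∀ e : {e // e ∈ G}, {p : Fin (2 * n + 1) → BV n // IsBPath e.1.1 e.1.2 p}

/-- The congestion of a vertex `w` of the double butterfly graph under a tuple
of paths: the number of edges of `G` whose path passes through `w`. -/
noncomputable def congestion {n : ℕ} (G : Finset ((Fin n → Bool) × (Fin n → Bool)))
    (W : PathTuple G) (w : BV n) : ℕ :=
  Nat.card {e : {e // e ∈ G} // ∃ i, (W e).1 i = w}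

open Finset in
/-- Chernoff-type counting bound: among all tuples with `W e ∈ P e`, where every `P e` has `M`
elements, few have many coordinates satisfying the events `A e`, provided these events have total
relative size at most `C`. -/
theorem card_tuples_many_events_mul_exp_le {ι : Type*} [Fintype ι] [DecidableEq ι] {P : ι → Type*}
    [∀ e, Fintype (P e)] (A : ∀ e, P e → Prop) [∀ e, DecidablePred (A e)] (M : ℕ) (hM : 0 < M)
    (hP : ∀ e, Fintype.card (P e) = M) (C : ℝ) (hC : (∑ e, #{p | A e p} : ℝ) ≤ C * M)
    (t s : ℝ) (ht : 0 ≤ t) :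
    (#{W : ∀ e, P e | s < #{e | A e (W e)}} : ℝ) * Real.exp (t * s) ≤
      Real.exp ((Real.exp t - 1) * C) * Fintype.card (∀ e, P e) := by
  have hM' : (0 : ℝ) < M := by exact_mod_cast hM
  have ht1 : 0 ≤ Real.exp t - 1 := by linarith [Real.add_one_le_exp t]
  have markov : (#{W : ∀ e, P e | s < #{e | A e (W e)}} : ℝ) * Real.exp (t * s) ≤
      ∑ W : ∀ e, P e, ∏ e, (if A e (W e) then Real.exp t else 1) := by
    rw [← nsmul_eq_mul, ← sum_const]
    refine (sum_le_sum fun W hW => ?_).trans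
      (sum_le_sum_of_subset_of_nonneg (subset_univ _) fun W _ _ =>
        prod_nonneg fun e _ => by split_ifs <;> positivity)
    rw [prod_ite, prod_const, prod_const_one, mul_one, ← Real.exp_nat_mul, Real.exp_le_exp,
      mul_comm]
    exact mul_le_mul_of_nonneg_right (mem_filter.1 hW).2.le ht
  have factor (e : ι) : ∑ p : P e, (if A e p then Real.exp t else 1) ≤
      M * Real.exp ((Real.exp t - 1) * (#{p | A e p} / M)) := by
    have h : ∑ p : P e, (if A e p then Real.exp t else 1) =
        M + (Real.exp t - 1) * #{p | A e p} := by
      have hsplit (p : P e) : (if A e p then Real.exp t else 1) =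
          1 + (Real.exp t - 1) * (if A e p then 1 else 0) := by split_ifs <;> ring
      simp_rw [hsplit, sum_add_distrib, ← mul_sum, sum_boole]
      simp [hP]
    rw [h]
    calc (M + (Real.exp t - 1) * #{p | A e p} : ℝ)
        = M * ((Real.exp t - 1) * (#{p | A e p} / M) + 1) := by field_simp; ring
      _ ≤ _ := by gcongr; exact Real.add_one_le_exp _
  refine markov.trans ?_
  rw [← Fintype.piFinset_univ,
    ← prod_univ_sum (fun e => (univ : Finset (P e))) fun e p => if A e p then Real.exp t else 1]
  refine (prod_le_prod (fun e _ => sum_nonneg fun p _ => by split_ifs <;> positivity)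
    fun e _ => factor e).trans ?_
  rw [prod_mul_distrib, ← Real.exp_sum, ← mul_sum, ← sum_div, Fintype.card_pi, mul_comm]
  simp only [hP, Nat.cast_prod]
  gcongr
  rwa [div_le_iff₀ hM']

open Finset in
theorem card_piecewise_eq_le {ι : Type*} [Fintype ι] [DecidableEq ι] (S : ι → Prop)
    [DecidablePred S] (x : ι → Bool) :
    ∑ a : ι → Bool, #{b : ι → Bool | (fun j => if S j then a j else b j) = x} ≤
      2 ^ Fintype.card ι := by
  rw [← card_sigma]
  have hcard : 2 ^ Fintype.card ι = #(univ : Finset (ι → Bool)) := by simp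
  rw [hcard]
  refine card_le_card_of_injOn (fun q j => if S j then q.2 j else q.1 j) (by simp) ?_
  rintro ⟨a, b⟩ h ⟨a', b'⟩ h' heq
  have h1 (j : ι) : (if S j then a j else b j) = if S j then a' j else b' j := by
    simp only [coe_sigma, Set.mem_sigma_iff, coe_filter, mem_univ, true_and, Set.mem_ofPred_eq,
      coe_univ, Set.mem_univ] at h h'
    exact congrFun (h.trans h'.symm) j
  have h2 (j : ι) : (if S j then b j else a j) = if S j then b' j else a' j := congrFun heq j
  obtain rfl : a = a' := by
    funext j; have := h1 j; have := h2 j; by_cases hj : S j <;> simp_all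
  obtain rfl : b = b' := by
    funext j; have := h1 j; have := h2 j; by_cases hj : S j <;> simp_all
  rfl

open Finset in
theorem sum_card_piecewise_eq_le {ι E : Type*} [Fintype ι] [DecidableEq ι] (G : Finset E)
    (g : E → ι → Bool) (Δ : ℕ) (hg : ∀ v, #{e ∈ G | g e = v} ≤ Δ) (S : ι → Prop)
    [DecidablePred S] (x : ι → Bool) :
    ∑ e ∈ G, #{b : ι → Bool | (fun j => if S j then g e j else b j) = x} ≤
      Δ * 2 ^ Fintype.card ι := by
  rw [← sum_fiberwise G g]
  calc _ = ∑ a : ι → Bool,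
          #{e ∈ G | g e = a} * #{b : ι → Bool | (fun j => if S j then a j else b j) = x} := by
        refine sum_congr rfl fun a _ => ?_
        rw [← smul_eq_mul, ← sum_const]
        exact sum_congr rfl fun e he => by rw [(mem_filter.1 he).2]
    _ ≤ ∑ a : ι → Bool, Δ * #{b : ι → Bool | (fun j => if S j then a j else b j) = x} := by
        gcongr with a; exact hg a
    _ ≤ _ := by rw [← mul_sum]; gcongr; exact card_piecewise_eq_le S x

/-- The string in position `k` of the butterfly path from `v` to `u` with middle string `m`. -/
def butterflyString {n : ℕ} (v u m : Fin n → Bool) (k : ℕ) : Fin n → Bool :=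
  fun j => if k ≤ j then v j else if k ≤ n + j then m j else u j

open Finset in
theorem sum_card_butterflyString_eq_le {n : ℕ} (Δ : ℕ) (G : Finset ((Fin n → Bool) × (Fin n → Bool)))
    (hout : ∀ v : Fin n → Bool, #{e ∈ G | e.1 = v} ≤ Δ)
    (hin : ∀ v : Fin n → Bool, #{e ∈ G | e.2 = v} ≤ Δ) (k : ℕ) (x : Fin n → Bool) :
    ∑ e ∈ G, #{m | butterflyString e.1 e.2 m k = x} ≤ Δ * 2 ^ n := by
  rcases le_total k n with hk | hk
  · have h (v u m : Fin n → Bool) :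
        butterflyString v u m k = fun j : Fin n => if k ≤ j then v j else m j := by
      funext j
      simp [butterflyString, show k ≤ n + j by omega]
    simpa only [h, Fintype.card_fin] using
      sum_card_piecewise_eq_le G Prod.fst Δ hout (fun j : Fin n => k ≤ j) x
  · have h (v u m : Fin n → Bool) :
        butterflyString v u m k = fun j : Fin n => if n + j < k then u j else m j := by
      funext j
      have := j.isLt
      simp only [butterflyString, show ¬ k ≤ j by omega, if_false]
      split_ifs <;> first | rfl | omega
    simpa only [h, Fintype.card_fin] using
      sum_card_piecewise_eq_le G Prod.snd Δ hin (fun j : Fin n => n + j < k) x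

theorem mod_eq_iff_of_lt_two_mul {n k j : ℕ} (hk : k < 2 * n) (hj : j < n) :
    k % n = j ↔ k = j ∨ k = n + j := by
  rcases lt_or_ge k n with h | h
  · rw [Nat.mod_eq_of_lt h]; omega
  · rw [Nat.mod_eq_sub_mod h, Nat.mod_eq_of_lt (by omega)]; omega

/-- The butterfly path from `v` to `u` with middle string `m`. -/
def butterflyPath {n : ℕ} (v u m : Fin n → Bool) (k : Fin (2 * n + 1)) : BV n :=
  (butterflyString v u m k, (k : ℕ))

theorem isBPath_butterflyPath {n : ℕ} (v u m : Fin n → Bool) :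
    IsBPath v u (butterflyPath v u m) := by
  refine ⟨?_, ?_, fun i => ⟨?_, ?_⟩⟩
  · ext <;> simp [butterflyPath, butterflyString]
  · refine Prod.ext (funext fun j => ?_) ?_
    · have := j.isLt
      simp [butterflyPath, butterflyString, show ¬ 2 * n ≤ j by omega,
        show ¬ 2 * n ≤ n + j by omega]
    · simp [butterflyPath, -Nat.cast_mul]
  · simp [butterflyPath]
  · have hi := i.isLt
    have hval : ((i : ℕ) : ZMod (2 * n)).val = i := ZMod.val_cast_of_lt hi
    have hpos : 0 < n := by omega
    have hne (j : Fin n) (hj : (j : ℕ) ≠ i % n) :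
        butterflyString v u m (i + 1) j = butterflyString v u m i j := by
      have := (mod_eq_iff_of_lt_two_mul hi j.isLt).not.1 (Ne.symm hj)
      unfold butterflyString
      split_ifs <;> first | rfl | omega
    let c : Fin n := ⟨i % n, Nat.mod_lt _ hpos⟩
    simp only [butterflyPath, Fin.val_castSucc, Fin.val_succ, hval]
    by_cases hc : butterflyString v u m (i + 1) c = butterflyString v u m i c
    · left
      funext j
      by_cases hj : (j : ℕ) = i % n
      · obtain rfl : j = c := Fin.ext hj
        exact hc
      · exact hne j hj
    · right
      funext j
      by_cases hj : (j : ℕ) = i % n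
      · obtain rfl : j = c := Fin.ext hj
        simpa [flipCoord, c] using Bool.eq_not.2 hc
      · simpa [flipCoord, hj] using hne j hj

theorem IsBPath.snd_eq {n : ℕ} {v u : Fin n → Bool} {p : Fin (2 * n + 1) → BV n}
    (hp : IsBPath v u p) (k : Fin (2 * n + 1)) : (p k).2 = (k : ℕ) := by
  induction k using Fin.induction with
  | zero => simp [hp.1]
  | succ i ih => simp [(hp.2.2 i).1, ih]

theorem IsBPath.fst_apply_eq {n : ℕ} {v u : Fin n → Bool} {p : Fin (2 * n + 1) → BV n}
    (hp : IsBPath v u p) (j : Fin n) {a b : ℕ} (hab : a ≤ b) (hb : b < 2 * n + 1)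
    (h : ∀ i, a ≤ i → i < b → i ≠ j ∧ i ≠ n + j) :
    (p ⟨b, hb⟩).1 j = (p ⟨a, by omega⟩).1 j := by
  induction b, hab using Nat.le_induction with
  | base => rfl
  | succ b hab ih =>
    rw [← ih (by omega) fun i hi hib => h i hi (by omega)]
    have hb' : b < 2 * n := by omega
    have hval : ((b : ℕ) : ZMod (2 * n)).val = b := ZMod.val_cast_of_lt hb'
    have hmod : (j : ℕ) ≠ b % n := fun hj => by
      have := (mod_eq_iff_of_lt_two_mul hb' j.isLt).1 hj.symm
      have := h b hab (by omega)
      omega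
    have hstep := (hp.2.2 ⟨b, hb'⟩).2
    rw [hp.snd_eq] at hstep
    simp only [Fin.castSucc_mk, Fin.succ_mk, hval] at hstep
    rcases hstep with h | h <;> rw [h]
    simp [flipCoord, hmod]

theorem IsBPath.eq_butterflyPath {n : ℕ} {v u : Fin n → Bool} {p : Fin (2 * n + 1) → BV n}
    (hp : IsBPath v u p) : p = butterflyPath v u (p ⟨n, by omega⟩).1 := by
  funext ⟨k, hk⟩
  refine Prod.ext (funext fun j => ?_) (hp.snd_eq _)
  have hj := j.isLt
  simp only [butterflyPath, butterflyString]
  split_ifs with h1 h2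
  · rw [hp.fst_apply_eq j (Nat.zero_le k) hk (by omega)]
    exact congrFun (congrArg Prod.fst hp.1) j
  · rcases le_total k n with h | h
    · exact (hp.fst_apply_eq j h (by omega) (by omega)).symm
    · exact hp.fst_apply_eq j h hk (by omega)
  · rw [← hp.fst_apply_eq j (show k ≤ 2 * n by omega) (by omega) (by omega)]
    exact congrFun (congrArg Prod.fst hp.2.1) j

theorem butterflyPath_middle {n : ℕ} (v u m : Fin n → Bool) :
    (butterflyPath v u m ⟨n, by omega⟩).1 = m := by
  funext j
  simp [butterflyPath, butterflyString]

/-- A butterfly path is determined by its middle string, which is arbitrary. -/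
def butterflyPathEquiv {n : ℕ} (v u : Fin n → Bool) :
    (Fin n → Bool) ≃ {p : Fin (2 * n + 1) → BV n // IsBPath v u p} where
  toFun m := ⟨butterflyPath v u m, isBPath_butterflyPath v u m⟩
  invFun p := (p.1 ⟨n, by omega⟩).1
  left_inv m := butterflyPath_middle v u m
  right_inv p := Subtype.ext p.2.eq_butterflyPath.symm

open Finset Classical in
theorem card_butterflyPath_through_le {n : ℕ} (v u : Fin n → Bool) (w : BV n)
    [Fintype {p : Fin (2 * n + 1) → BV n // IsBPath v u p}] :
    #{p : {p : Fin (2 * n + 1) → BV n // IsBPath v u p} | ∃ i, p.1 i = w} ≤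
      #{m | butterflyString v u m w.2.val = w.1} + #{m | butterflyString v u m (2 * n) = w.1} := by
  rw [card_equiv (butterflyPathEquiv v u).symm (t := {m | ∃ i, butterflyPath v u m i = w})]
  · refine (card_le_card fun m hm => ?_).trans (card_union_le _ _)
    obtain ⟨i, rfl⟩ := (mem_filter.1 hm).2
    rcases (Nat.lt_succ_iff.1 i.isLt).lt_or_eq with hi | hi
    · simp [butterflyPath, ZMod.val_cast_of_lt hi]
    · simp [butterflyPath, hi]
  · intro p
    obtain ⟨m, rfl⟩ := (butterflyPathEquiv v u).surjective p
    simp [butterflyPathEquiv, butterflyPath_middle]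

open Finset Classical in
theorem card_congestion_gt_mul_exp_le {n : ℕ} (hn : 0 < n) (Δ : ℕ)
    (G : Finset ((Fin n → Bool) × (Fin n → Bool)))
    (hout : ∀ v : Fin n → Bool, #{e ∈ G | e.1 = v} ≤ Δ)
    (hin : ∀ v : Fin n → Bool, #{e ∈ G | e.2 = v} ≤ Δ) [Fintype (PathTuple G)]
    (w : BV n) (t s : ℝ) (ht : 0 ≤ t) :
    (#{W : PathTuple G | s < congestion G W w} : ℝ) * Real.exp (t * s) ≤
      Real.exp ((Real.exp t - 1) * (2 * Δ)) * Fintype.card (PathTuple G) := by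
  have : NeZero (2 * n) := ⟨by omega⟩
  have hsum : ∑ e : {e // e ∈ G}, #{p : {p : Fin (2 * n + 1) → BV n // IsBPath e.1.1 e.1.2 p} |
      ∃ i, p.1 i = w} ≤ 2 * Δ * 2 ^ n := by
    refine (sum_le_sum fun e _ => card_butterflyPath_through_le _ _ w).trans ?_
    rw [sum_coe_sort G fun e => #{m | butterflyString e.1 e.2 m w.2.val = w.1} +
      #{m | butterflyString e.1 e.2 m (2 * n) = w.1}, sum_add_distrib]
    have h1 := sum_card_butterflyString_eq_le Δ G hout hin w.2.val w.1
    have h2 := sum_card_butterflyString_eq_le Δ G hout hin (2 * n) w.1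
    linarith
  have key := card_tuples_many_events_mul_exp_le
    (P := fun e : {e // e ∈ G} => {p : Fin (2 * n + 1) → BV n // IsBPath e.1.1 e.1.2 p})
    (fun e p => ∃ i, p.1 i = w) (2 ^ n) (by positivity)
    (fun e => by rw [← Fintype.card_congr (butterflyPathEquiv _ _)]; simp) (2 * Δ)
    (by exact_mod_cast hsum) t s ht
  have hcong (W : PathTuple G) : congestion G W w = #{e | ∃ i, (W e).1 i = w} := by
    rw [congestion, Nat.card_eq_fintype_card, Fintype.card_subtype]
  simp_rw [hcong]
  convert key

open Filter Topology in
theorem eventually_card_mul_exp_le (ε : ℝ) (hε : 0 < ε) (K : ℝ) :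
    ∀ᶠ n : ℕ in atTop, 2 ^ n * (2 * n) * (K * Real.exp (-(2 * n))) ≤ ε := by
  rcases le_or_gt K 0 with hK | hK
  · refine Eventually.of_forall fun n => le_trans ?_ hε.le
    exact mul_nonpos_of_nonneg_of_nonpos (by positivity)
      (mul_nonpos_of_nonpos_of_nonneg hK (by positivity))
  have hlim : Tendsto (fun n : ℕ => 2 * K * ((n : ℝ) ^ 1 * Real.exp (-n))) atTop (𝓝 0) := by
    simpa using ((Real.tendsto_pow_mul_exp_neg_atTop_nhds_zero 1).comp
      tendsto_natCast_atTop_atTop).const_mul (2 * K)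
  filter_upwards [hlim.eventually (ge_mem_nhds hε)] with n hn
  refine le_trans ?_ hn
  have h2 : (2 : ℝ) ^ n ≤ Real.exp n := by
    rw [← mul_one (n : ℝ), Real.exp_nat_mul]
    gcongr
    linarith [Real.add_one_le_exp 1]
  calc 2 ^ n * (2 * n) * (K * Real.exp (-(2 * n)))
      ≤ Real.exp n * (2 * n) * (K * Real.exp (-(2 * n))) := by gcongr
    _ = 2 * K * (n ^ 1 * (Real.exp n * Real.exp (-(2 * n)))) := by ring
    _ = _ := by rw [← Real.exp_add]; ring_nf

/-- For every degree bound `Δ` and every `ε > 0`, for all sufficiently large `n`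
and every digraph `G` on `{0,1}^n` with all in- and out-degrees at most `Δ`,
with probability at least `1 − ε` (over an independent uniform choice of a
minimum-length butterfly path for each edge of `G`) every vertex of the double
butterfly graph has congestion at most `ε·n`. -/
theorem stmt3 (Δ : ℕ) (ε : ℝ) (hε : 0 < ε) :
    ∃ n₀ : ℕ, ∀ n : ℕ, n₀ ≤ n →
      ∀ G : Finset ((Fin n → Bool) × (Fin n → Bool)),
        (∀ v : Fin n → Bool, (G.filter (fun e => e.1 = v)).card ≤ Δ) →
        (∀ v : Fin n → Bool, (G.filter (fun e => e.2 = v)).card ≤ Δ) →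
        (1 - ε) * (Nat.card (PathTuple G) : ℝ) ≤
          (Nat.card {W : PathTuple G //
            ∀ w : BV n, (congestion G W w : ℝ) ≤ ε * n} : ℝ) := by
  classical
  obtain ⟨n₀, hn₀⟩ := Filter.eventually_atTop.1 (eventually_card_mul_exp_le ε hε
    (Real.exp ((Real.exp (2 / ε) - 1) * (2 * Δ))))
  refine ⟨max n₀ 1, fun n hn G hout hin => ?_⟩
  have hpos : 0 < n := by omega
  have : NeZero (2 * n) := ⟨by omega⟩
  let _ : Fintype (PathTuple G) := Fintype.ofFinite _
  rw [Nat.card_eq_fintype_card, Nat.card_eq_fintype_card, Fintype.card_subtype]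
  have hbad (w : BV n) : ((Finset.univ.filter fun W : PathTuple G =>
      ε * n < congestion G W w).card : ℝ) ≤
      Real.exp ((Real.exp (2 / ε) - 1) * (2 * Δ)) * Real.exp (-(2 * n)) *
        Fintype.card (PathTuple G) := by
    have h := card_congestion_gt_mul_exp_le hpos Δ G hout hin w (2 / ε) (ε * n) (by positivity)
    rw [show 2 / ε * (ε * n) = 2 * n by field_simp] at h
    rw [Real.exp_neg, mul_right_comm, ← div_eq_mul_inv, le_div_iff₀ (Real.exp_pos _)]
    exact h
  have hunion : ((Finset.univ.filter fun W : PathTuple G =>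
      ¬ ∀ w : BV n, (congestion G W w : ℝ) ≤ ε * n).card : ℝ) ≤
      ∑ w : BV n, ((Finset.univ.filter fun W : PathTuple G =>
        ε * n < congestion G W w).card : ℝ) := by
    rw [← Nat.cast_sum, Nat.cast_le]
    refine (Finset.card_le_card fun W hW => ?_).trans Finset.card_biUnion_le
    simpa using hW
  have hcard : (Fintype.card (BV n) : ℝ) = 2 ^ n * (2 * n) := by
    simp [ZMod.card]
  have hbound := hunion.trans (Finset.sum_le_sum fun w _ => hbad w)
  rw [Finset.sum_const, nsmul_eq_mul, Finset.card_univ, hcard, ← mul_assoc] at hbound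
  have hε' := mul_le_mul_of_nonneg_right (hn₀ n (by omega))
    (Nat.cast_nonneg (α := ℝ) (Fintype.card (PathTuple G)))
  have htotal := Finset.card_filter_add_card_filter_not (s := Finset.univ)
    fun W : PathTuple G => ∀ w : BV n, (congestion G W w : ℝ) ≤ ε * n
  rw [Finset.card_univ] at htotal
  have htotal' := congrArg (Nat.cast (R := ℝ)) htotal
  push_cast at htotal'
  linarith
end

section
/- For every ρ ∈ (0,1] there exists η > 0 such that the following holds for all n, m ≥ 1, every Enc : {0,1}^n → {0,1}^m with relative distance ρ, and every pointer graph G on {0,1}^n: for any two Brouwer line segments of G that are neither equal nor consecutive, every point p on one segment and every point p' on the other satisfy ‖p − p'‖₂ ≥ η in the normalized ℓ₂ norm on ℝ^{4m}. -/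
/-!
STATEMENT 6: Non-consecutive, distinct Brouwer line segments of a pointer
graph are `η`-separated in the normalized `ℓ₂` norm, where `η` depends only on
the relative distance `ρ` of the code.
-/

/-- The normalized `ℓ₂` norm. -/
noncomputable def nnorm {ι : Type*} [Fintype ι] (x : ι → ℝ) : ℝ :=
  Real.sqrt ((∑ i, x i ^ 2) / (Fintype.card ι : ℝ))

/-- Points of `ℝ^{4m} = (ℝ^m)^4`. -/
abbrev Sp (m : ℕ) := Fin 4 × Fin m → ℝ

/-- The real vector in `ℝ^m` corresponding to a boolean string. -/
def encR {n m : ℕ} (Enc : (Fin n → Bool) → Fin m → Bool) (v : Fin n → Bool) :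
    Fin m → ℝ :=
  fun i => if Enc v i then 1 else 0

/-- The point of `ℝ^{4m}` with the four `m`-blocks `a, b, c, d`. -/
def quad {m : ℕ} (a b c d : Fin m → ℝ) : Sp m :=
  fun p => ![a, b, c, d] p.1 p.2

/-- The five points `x¹(u,v), …, x⁵(u,v)` (indexed by `Fin 5`). -/
def pt {n m : ℕ} (Enc : (Fin n → Bool) → Fin m → Bool) (u v : Fin n → Bool) :
    Fin 5 → Sp m :=
  ![quad (encR Enc u) (encR Enc u) 0 0,
    quad (encR Enc u) (encR Enc v) 0 0,
    quad (encR Enc u) (encR Enc v) 1 0,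
    quad (encR Enc v) (encR Enc v) 1 0,
    quad (encR Enc v) (encR Enc v) 0 0]

/-- `Enc` has relative distance `ρ`: encodings of distinct strings differ in at
least `ρ·m` coordinates. -/
def RelDist {n m : ℕ} (ρ : ℝ) (Enc : (Fin n → Bool) → Fin m → Bool) : Prop :=
  ∀ u v : Fin n → Bool, u ≠ v →
    ρ * m ≤ ((Finset.univ.filter (fun i => Enc u i ≠ Enc v i)).card : ℝ)

/-- A pointer graph: in- and out-degrees at most 1, no self-loops. -/
def PointerGraph {V : Type*} (E : V → V → Prop) : Prop :=
  (∀ v, ¬ E v v) ∧ (∀ u v v', E u v → E u v' → v = v') ∧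
  (∀ u u' v, E u v → E u' v → u = u')

/-- Index of a Brouwer line segment: a pair of vertices together with
`τ : Fin 4`; the segment runs from `pt Enc u v τ` to `pt Enc u v (τ+1)`. -/
structure SegIdx (n : ℕ) where
  u : Fin n → Bool
  v : Fin n → Bool
  τ : Fin 4

/-- Two Brouwer line segments are consecutive: either the `τ`-th and
`(τ+1)`-st segments of the same edge, or one is the 4th segment of an edge
`(u→v)` and the other the 1st segment of an edge `(v→w)`. -/
def Consecutive {n : ℕ} (s t : SegIdx n) : Prop :=
  (s.u = t.u ∧ s.v = t.v ∧ (t.τ.val = s.τ.val + 1 ∨ s.τ.val = t.τ.val + 1)) ∨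
  (s.τ.val = 3 ∧ t.τ.val = 0 ∧ t.u = s.v) ∨
  (t.τ.val = 3 ∧ s.τ.val = 0 ∧ s.u = t.v)

theorem mem_segment_apply_eq {ι : Type*} {x y p : ι → ℝ} {i : ι} {c : ℝ}
    (hx : x i = c) (hy : y i = c) (hp : p ∈ segment ℝ x y) : p i = c := by
  obtain ⟨a, b, -, -, hab, rfl⟩ := hp
  simp only [Pi.add_apply, Pi.smul_apply, smul_eq_mul, hx, hy]
  rw [← add_mul, hab, one_mul]

/-- The vertex encoded in the first block of a segment on which that block is constant. -/
def SegIdx.tail {n : ℕ} (s : SegIdx n) : Fin n → Bool :=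
  if s.τ = 3 then s.v else s.u

theorem segment_first_block {n m : ℕ} (Enc : (Fin n → Bool) → Fin m → Bool) {s : SegIdx n}
    {p : Sp m} (hp : p ∈ segment ℝ (pt Enc s.u s.v s.τ.castSucc) (pt Enc s.u s.v s.τ.succ))
    (hs : s.τ ≠ 2) (i : Fin m) : p (0, i) = encR Enc s.tail i := by
  obtain ⟨u, v, τ⟩ := s
  refine mem_segment_apply_eq ?_ ?_ hp <;> fin_cases τ <;>
    simp_all [pt, quad, SegIdx.tail]

theorem segment_second_block {n m : ℕ} (Enc : (Fin n → Bool) → Fin m → Bool) {s : SegIdx n}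
    {p : Sp m} (hp : p ∈ segment ℝ (pt Enc s.u s.v s.τ.castSucc) (pt Enc s.u s.v s.τ.succ))
    (hs : s.τ ≠ 0) (i : Fin m) : p (1, i) = encR Enc s.v i := by
  obtain ⟨u, v, τ⟩ := s
  refine mem_segment_apply_eq ?_ ?_ hp <;> fin_cases τ <;> simp_all [pt, quad]

theorem segment_third_block_eq_zero {n m : ℕ} (Enc : (Fin n → Bool) → Fin m → Bool) {s : SegIdx n}
    {p : Sp m} (hp : p ∈ segment ℝ (pt Enc s.u s.v s.τ.castSucc) (pt Enc s.u s.v s.τ.succ))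
    (hs : s.τ = 0) (i : Fin m) : p (2, i) = 0 := by
  obtain ⟨u, v, τ⟩ := s
  subst hs
  refine mem_segment_apply_eq ?_ ?_ hp <;> simp [pt, quad]

theorem segment_third_block_eq_one {n m : ℕ} (Enc : (Fin n → Bool) → Fin m → Bool) {s : SegIdx n}
    {p : Sp m} (hp : p ∈ segment ℝ (pt Enc s.u s.v s.τ.castSucc) (pt Enc s.u s.v s.τ.succ))
    (hs : s.τ = 2) (i : Fin m) : p (2, i) = 1 := by
  obtain ⟨u, v, τ⟩ := s
  subst hs
  refine mem_segment_apply_eq ?_ ?_ hp <;> simp [pt, quad]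

theorem PointerGraph.exists_distinguishing_block {n : ℕ}
    {E : (Fin n → Bool) → (Fin n → Bool) → Prop} (hE : PointerGraph E) {s t : SegIdx n}
    (hs : E s.u s.v) (ht : E t.u t.v) (hne : s ≠ t) (hc : ¬ Consecutive s t) :
    (s.τ ≠ 2 ∧ t.τ ≠ 2 ∧ s.tail ≠ t.tail) ∨ (s.τ ≠ 0 ∧ t.τ ≠ 0 ∧ s.v ≠ t.v) ∨
      (s.τ = 0 ∧ t.τ = 2) ∨ (s.τ = 2 ∧ t.τ = 0) := by
  obtain ⟨hloop, hout, hin⟩ := hE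
  obtain ⟨u, v, τ⟩ := s
  obtain ⟨u', v', τ'⟩ := t
  have h₁ : u = u' → v = v' := by rintro rfl; exact hout _ _ _ hs ht
  have h₂ : v = v' → u = u' := by rintro rfl; exact hin _ _ _ hs ht
  have h₃ : u ≠ v := by rintro rfl; exact hloop _ hs
  have h₄ : u' ≠ v' := by rintro rfl; exact hloop _ ht
  clear hs ht hloop hout hin
  fin_cases τ <;> fin_cases τ' <;> simp [Consecutive, SegIdx.tail] at * <;> grind

theorem mul_le_sum_sq_encR_sub {n m : ℕ} {ρ : ℝ} {Enc : (Fin n → Bool) → Fin m → Bool}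
    (hEnc : RelDist ρ Enc) {u v : Fin n → Bool} (huv : u ≠ v) :
    ρ * m ≤ ∑ i, (encR Enc u i - encR Enc v i) ^ 2 := by
  refine (hEnc u v huv).trans_eq ?_
  rw [Finset.card_filter, Nat.cast_sum]
  refine Finset.sum_congr rfl fun i _ => ?_
  cases hu : Enc u i <;> cases hv : Enc v i <;> simp [encR, hu, hv]

theorem sqrt_div_four_le_nnorm {m : ℕ} (hm : 1 ≤ m) {ρ : ℝ} (x : Sp m) (k : Fin 4)
    (h : ρ * m ≤ ∑ i, x (k, i) ^ 2) : √(ρ / 4) ≤ nnorm x := by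
  have hm' : (0 : ℝ) < m := by exact_mod_cast hm
  refine Real.sqrt_le_sqrt ?_
  have hle : ∑ i, x (k, i) ^ 2 ≤ ∑ j, x j ^ 2 := by
    rw [Fintype.sum_prod_type]
    exact Finset.single_le_sum (f := fun k => ∑ i, x (k, i) ^ 2)
      (fun _ _ => Finset.sum_nonneg fun _ _ => sq_nonneg _) (Finset.mem_univ k)
  simp only [Fintype.card_prod, Fintype.card_fin, Nat.cast_mul, Nat.cast_ofNat]
  rw [div_le_div_iff₀ (by norm_num) (by positivity)]
  linarith

theorem stmt6 (ρ : ℝ) (hρ0 : 0 < ρ) (hρ1 : ρ ≤ 1) :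
    ∃ η : ℝ, 0 < η ∧
      ∀ (n m : ℕ), 1 ≤ n → 1 ≤ m →
        ∀ Enc : (Fin n → Bool) → Fin m → Bool, RelDist ρ Enc →
          ∀ E : (Fin n → Bool) → (Fin n → Bool) → Prop, PointerGraph E →
            ∀ s t : SegIdx n, E s.u s.v → E t.u t.v →
              s ≠ t → ¬ Consecutive s t →
              ∀ p ∈ segment ℝ (pt Enc s.u s.v s.τ.castSucc) (pt Enc s.u s.v s.τ.succ),
                ∀ p' ∈ segment ℝ (pt Enc t.u t.v t.τ.castSucc) (pt Enc t.u t.v t.τ.succ),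
                  η ≤ nnorm (p - p') := by
  refine ⟨√(ρ / 4), by positivity, ?_⟩
  intro n m _ hm Enc hEnc E hE s t hs ht hne hc p hp p' hp'
  rcases hE.exists_distinguishing_block hs ht hne hc with
    ⟨h, h', hst⟩ | ⟨h, h', hst⟩ | ⟨h, h'⟩ | ⟨h, h'⟩
  · refine sqrt_div_four_le_nnorm hm _ 0 ?_
    simpa only [Pi.sub_apply, segment_first_block Enc hp h, segment_first_block Enc hp' h']
      using mul_le_sum_sq_encR_sub hEnc hst
  · refine sqrt_div_four_le_nnorm hm _ 1 ?_
    simpa only [Pi.sub_apply, segment_second_block Enc hp h, segment_second_block Enc hp' h']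
      using mul_le_sum_sq_encR_sub hEnc hst
  · refine sqrt_div_four_le_nnorm hm _ 2 ?_
    simpa [segment_third_block_eq_zero Enc hp h, segment_third_block_eq_one Enc hp' h']
      using mul_le_of_le_one_left (Nat.cast_nonneg m) hρ1
  · refine sqrt_div_four_le_nnorm hm _ 2 ?_
    simpa [segment_third_block_eq_one Enc hp h, segment_third_block_eq_zero Enc hp' h']
      using mul_le_of_le_one_left (Nat.cast_nonneg m) hρ1
end

section
/- Let E be a real inner product space, let s, y, t ∈ E satisfy ⟨y − s, t − y⟩ = 0 and ‖y − s‖ = ‖t − y‖ = 1, and fix h ∈ (0,1). Then for every x ∈ E with Δ₁(x) + Δ₂(x) ≠ 0, the vector z(x) − x is orthogonal to ψ(x)·(y − s) + (1 − ψ(x))·(t − y); that is, ⟨z(x) − x, ψ(x)·(y − s) + (1 − ψ(x))·(t − y)⟩ = 0. -/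
/-!
STATEMENT 8: Near a Brouwer vertex, the vector `z(x) − x` is orthogonal to the
interpolated direction `ψ(x)·(y − s) + (1 − ψ(x))·(t − y)`.
-/

open scoped RealInnerProductSpace

variable {E : Type*} [NormedAddCommGroup E] [InnerProductSpace ℝ E]

noncomputable section

/-- `τ₁(x) = ⟨y − s, x − s⟩`. -/
def tau1 (s y x : E) : ℝ := ⟪y - s, x - s⟫

/-- `τ₂(x) = ⟨t − y, x − y⟩`. -/
def tau2 (y t x : E) : ℝ := ⟪t - y, x - y⟫

/-- `Δ₁(x) = τ₁(x) − (1 − √h)`. -/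
def Del1 (h : ℝ) (s y x : E) : ℝ := tau1 s y x - (1 - Real.sqrt h)

/-- `Δ₂(x) = √h − τ₂(x)`. -/
def Del2 (h : ℝ) (y t x : E) : ℝ := Real.sqrt h - tau2 y t x

/-- `z₁ = y − √h·(y − s)`. -/
def zOne (h : ℝ) (s y : E) : E := y - Real.sqrt h • (y - s)

/-- `z₂ = y + √h·(t − y)`. -/
def zTwo (h : ℝ) (y t : E) : E := y + Real.sqrt h • (t - y)

/-- `ψ(x) = Δ₂(x)/(Δ₁(x) + Δ₂(x))`. -/
def psi (h : ℝ) (s y t x : E) : ℝ :=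
  Del2 h y t x / (Del1 h s y x + Del2 h y t x)

/-- `z(x) = ψ(x)·z₁ + (1 − ψ(x))·z₂`. -/
def zPt (h : ℝ) (s y t x : E) : E :=
  psi h s y t x • zOne h s y + (1 - psi h s y t x) • zTwo h y t

end

theorem stmt8 (s y t : E) (horth : ⟪y - s, t - y⟫ = 0)
    (hns : ‖y - s‖ = 1) (hnt : ‖t - y‖ = 1) (h : ℝ) (hh0 : 0 < h) (hh1 : h < 1) :
    ∀ x : E, Del1 h s y x + Del2 h y t x ≠ 0 →
      ⟪zPt h s y t x - x,
        psi h s y t x • (y - s) + (1 - psi h s y t x) • (t - y)⟫ = 0 := by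
  intro x hx
  have hz : zPt h s y t x - x =
      (1 - psi h s y t x) • Real.sqrt h • (t - y) - psi h s y t x • Real.sqrt h • (y - s)
        - (x - y) := by
    simp only [zPt, zOne, zTwo]
    module
  have htau : tau1 s y x = ⟪y - s, x - y⟫ + 1 := by
    rw [tau1, ← sub_add_sub_cancel x y s, inner_add_right, real_inner_self_eq_norm_sq, hns,
      one_pow]
  have hpsi : psi h s y t x * (Del1 h s y x + Del2 h y t x) = Del2 h y t x :=
    div_mul_cancel₀ _ hx
  simp only [Del1, Del2, htau, tau2] at hpsi
  rw [hz]
  clear hz htau hx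
  generalize psi h s y t x = p at hpsi ⊢
  generalize y - s = u at *
  generalize t - y = v at *
  generalize x - y = w at *
  simp only [inner_sub_left, inner_add_right, real_inner_smul_left, real_inner_smul_right]
  rw [real_inner_comm u v, real_inner_comm u w, real_inner_comm v w]
  simp only [horth, real_inner_self_eq_norm_sq, hns, hnt]
  linear_combination -hpsi
end

section
/- Let E be a real inner product space, let s, y, t ∈ E satisfy ⟨y − s, t − y⟩ = 0 and ‖y − s‖ = ‖t − y‖ = 1, and fix h ∈ (0,1). Then: (a) for every λ ∈ ℝ, the point z = λ·z₁ + (1 − λ)·z₂ satisfies Δ₁(z) + Δ₂(z) = √h; and (b) for every x ∈ E and every point z on the line segment from z₁ to z₂, Δ₁(x) + Δ₂(x) ≥ √h − 2·‖x − z‖. -/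
/-!
STATEMENT 9: (a) On the line through `z₁` and `z₂` we have `Δ₁ + Δ₂ = √h`;
(b) in general `Δ₁(x) + Δ₂(x) ≥ √h − 2‖x − z‖` for any `z` on the segment
`[z₁, z₂]`.
-/

open scoped RealInnerProductSpace

variable {E : Type*} [NormedAddCommGroup E] [InnerProductSpace ℝ E]

theorem Del1_add_Del2_lineCombination {s y t : E} (horth : ⟪y - s, t - y⟫ = 0)
    (hns : ‖y - s‖ = 1) (hnt : ‖t - y‖ = 1) (h l : ℝ) :
    Del1 h s y (l • zOne h s y + (1 - l) • zTwo h y t) +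
      Del2 h y t (l • zOne h s y + (1 - l) • zTwo h y t) = Real.sqrt h := by
  have e₁ : l • zOne h s y + (1 - l) • zTwo h y t - s =
      (1 - l * Real.sqrt h) • (y - s) + ((1 - l) * Real.sqrt h) • (t - y) := by
    unfold zOne zTwo
    module
  have e₂ : l • zOne h s y + (1 - l) • zTwo h y t - y =
      (-(l * Real.sqrt h)) • (y - s) + ((1 - l) * Real.sqrt h) • (t - y) := by
    unfold zOne zTwo
    module
  have horth' : ⟪t - y, y - s⟫ = 0 := by rw [real_inner_comm, horth]
  unfold Del1 Del2 tau1 tau2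
  rw [e₁, e₂]
  simp only [inner_add_right, real_inner_smul_right, real_inner_self_eq_norm_sq, horth, horth',
    hns, hnt]
  ring

theorem Del1_sub_Del1_le {s y : E} (hns : ‖y - s‖ = 1) (h : ℝ) (x z : E) :
    Del1 h s y z - Del1 h s y x ≤ ‖x - z‖ := by
  have hle := real_inner_le_norm (y - s) (z - x)
  rw [hns, one_mul, norm_sub_rev, ← sub_sub_sub_cancel_right z x s, inner_sub_right] at hle
  unfold Del1 tau1
  linarith

theorem Del2_sub_Del2_le {y t : E} (hnt : ‖t - y‖ = 1) (h : ℝ) (x z : E) :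
    Del2 h y t z - Del2 h y t x ≤ ‖x - z‖ := by
  have hle := real_inner_le_norm (t - y) (x - z)
  rw [hnt, one_mul, ← sub_sub_sub_cancel_right x z y, inner_sub_right,
    sub_sub_sub_cancel_right] at hle
  unfold Del2 tau2
  linarith

theorem stmt9 (s y t : E) (horth : ⟪y - s, t - y⟫ = 0)
    (hns : ‖y - s‖ = 1) (hnt : ‖t - y‖ = 1) (h : ℝ) (hh0 : 0 < h) (hh1 : h < 1) :
    -- (a)
    (∀ l : ℝ,
      Del1 h s y (l • zOne h s y + (1 - l) • zTwo h y t) +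
        Del2 h y t (l • zOne h s y + (1 - l) • zTwo h y t) = Real.sqrt h) ∧
    -- (b)
    (∀ x : E, ∀ z ∈ segment ℝ (zOne h s y) (zTwo h y t),
      Real.sqrt h - 2 * ‖x - z‖ ≤ Del1 h s y x + Del2 h y t x) := by
  refine ⟨Del1_add_Del2_lineCombination horth hns hnt h, ?_⟩
  rintro x z ⟨a, b, -, -, hab, rfl⟩
  obtain rfl : b = 1 - a := by linarith
  have hz := Del1_add_Del2_lineCombination horth hns hnt h a
  have h₁ := Del1_sub_Del1_le hns h x (a • zOne h s y + (1 - a) • zTwo h y t)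
  have h₂ := Del2_sub_Del2_le hnt h x (a • zOne h s y + (1 - a) • zTwo h y t)
  linarith
end

section
/- Let E be a real inner product space, let s, y, t ∈ E satisfy ⟨y − s, t − y⟩ = 0 and ‖y − s‖ = ‖t − y‖ = 1, and fix h ∈ (0,1). Let s₀ > 0 and suppose x, x' ∈ E satisfy Δ₁(x) ≥ 0, Δ₂(x) ≥ 0, Δ₁(x') ≥ 0, Δ₂(x') ≥ 0, Δ₁(x) + Δ₂(x) ≥ s₀, and Δ₁(x') + Δ₂(x') ≥ s₀. Then |ψ(x) − ψ(x')| ≤ ‖x − x'‖ / s₀. -/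
/-!
STATEMENT 10: Lipschitz continuity of the interpolation parameter `ψ` on the
region where `Δ₁, Δ₂ ≥ 0` and `Δ₁ + Δ₂ ≥ s₀`.
-/

open scoped RealInnerProductSpace

variable {E : Type*} [NormedAddCommGroup E] [InnerProductSpace ℝ E]

/-- For unit vectors and nonnegative weights, `|a⟪f, d⟫ + b⟪e, d⟫| ≤ (a + b)‖d‖`. -/
theorem abs_weighted_inner_add_le {e f : E} (he : ‖e‖ = 1) (hf : ‖f‖ = 1) {a b : ℝ}
    (ha : 0 ≤ a) (hb : 0 ≤ b) (d : E) :
    |a * ⟪f, d⟫ + b * ⟪e, d⟫| ≤ (a + b) * ‖d‖ := by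
  have hfd : |⟪f, d⟫| ≤ ‖d‖ := by simpa [hf] using abs_real_inner_le_norm f d
  have hed : |⟪e, d⟫| ≤ ‖d‖ := by simpa [he] using abs_real_inner_le_norm e d
  calc |a * ⟪f, d⟫ + b * ⟪e, d⟫| ≤ |a * ⟪f, d⟫| + |b * ⟪e, d⟫| := abs_add_le _ _
    _ = a * |⟪f, d⟫| + b * |⟪e, d⟫| := by
      rw [abs_mul, abs_mul, abs_of_nonneg ha, abs_of_nonneg hb]
    _ ≤ a * ‖d‖ + b * ‖d‖ := by gcongr
    _ = (a + b) * ‖d‖ := by ring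

theorem Del1_eq_add_inner (h : ℝ) (s y x x' : E) :
    Del1 h s y x = Del1 h s y x' + ⟪y - s, x - x'⟫ := by
  simp only [Del1, tau1, inner_sub_right]
  ring

theorem Del2_eq_sub_inner (h : ℝ) (y t x x' : E) :
    Del2 h y t x = Del2 h y t x' - ⟪t - y, x - x'⟫ := by
  simp only [Del2, tau2, inner_sub_right]
  ring

theorem stmt10 (s y t : E) (horth : ⟪y - s, t - y⟫ = 0)
    (hns : ‖y - s‖ = 1) (hnt : ‖t - y‖ = 1) (h : ℝ) (hh0 : 0 < h) (hh1 : h < 1)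
    (s₀ : ℝ) (hs₀ : 0 < s₀) (x x' : E)
    (h1 : 0 ≤ Del1 h s y x) (h2 : 0 ≤ Del2 h y t x)
    (h1' : 0 ≤ Del1 h s y x') (h2' : 0 ≤ Del2 h y t x')
    (hsum : s₀ ≤ Del1 h s y x + Del2 h y t x)
    (hsum' : s₀ ≤ Del1 h s y x' + Del2 h y t x') :
    |psi h s y t x - psi h s y t x'| ≤ ‖x - x'‖ / s₀ := by
  have hS : 0 < Del1 h s y x + Del2 h y t x := hs₀.trans_le hsum
  have hS' : 0 < Del1 h s y x' + Del2 h y t x' := hs₀.trans_le hsum'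
  have hdiff : psi h s y t x - psi h s y t x' =
      -(Del1 h s y x' * ⟪t - y, x - x'⟫ + Del2 h y t x' * ⟪y - s, x - x'⟫) /
        ((Del1 h s y x + Del2 h y t x) * (Del1 h s y x' + Del2 h y t x')) := by
    rw [psi, psi, div_sub_div _ _ hS.ne' hS'.ne']
    congr 1
    rw [Del1_eq_add_inner h s y x x', Del2_eq_sub_inner h y t x x']
    ring
  rw [hdiff, abs_div, abs_neg, abs_of_pos (mul_pos hS hS')]
  calc _ ≤ (Del1 h s y x' + Del2 h y t x') * ‖x - x'‖ /
        ((Del1 h s y x + Del2 h y t x) * (Del1 h s y x' + Del2 h y t x')) := by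
        gcongr
        exact abs_weighted_inner_add_le hns hnt h1' h2' _
    _ = ‖x - x'‖ / (Del1 h s y x + Del2 h y t x) := by
        rw [mul_comm (Del1 h s y x + Del2 h y t x), mul_div_mul_left _ _ hS'.ne']
    _ ≤ ‖x - x'‖ / s₀ := by gcongr
end

section
/- Let n ≥ 2 be even and let a₁ ≥ a₂ ≥ … ≥ a_n be real numbers satisfying Σ_{i=1}^n a_i = 0 and Σ_{i=1}^{n/2} a_i ≤ θ for some θ ≥ 0. Then Σ_{i=1}^n |a_i| ≤ 4θ. -/
/-!
STATEMENT 11: (Daskalakis–Papadimitriou) If `a₁ ≥ … ≥ a_n` (here 0-indexed: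
`a 0 ≥ a 1 ≥ … ≥ a (n−1)`), the total sum is 0 and the sum of the first half
is at most `θ`, then the sum of absolute values is at most `4θ`.
-/

theorem stmt11 (n : ℕ) (hn2 : 2 ≤ n) (heven : n % 2 = 0)
    (a : ℕ → ℝ) (θ : ℝ) (hθ : 0 ≤ θ)
    (hmono : ∀ i j, i ≤ j → j < n → a j ≤ a i)
    (hsum : ∑ i ∈ Finset.range n, a i = 0)
    (hhalf : ∑ i ∈ Finset.range (n / 2), a i ≤ θ) :
    ∑ i ∈ Finset.range n, |a i| ≤ 4 * θ := by
  obtain ⟨m, rfl⟩ : ∃ m, n = m + m := ⟨n / 2, by omega⟩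
  rw [show (m + m) / 2 = m by omega] at hhalf
  rw [Finset.sum_range_add] at hsum ⊢
  rw [← Finset.sum_add_distrib]
  have hab : ∀ i ∈ Finset.range m, a m ≤ a i ∧ a (m + i) ≤ a m := fun i hi => by
    have := Finset.mem_range.mp hi
    exact ⟨hmono i m (by omega) (by omega), hmono m (m + i) (by omega) (by omega)⟩
  rcases le_total 0 (a m) with hc | hc
  · have h : ∑ i ∈ Finset.range m, (|a i| + |a (m + i)|) ≤
        ∑ i ∈ Finset.range m, (3 * a i - a (m + i)) := by
      refine Finset.sum_le_sum fun i hi => ?_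
      obtain ⟨h₁, h₂⟩ := hab i hi
      rcases abs_cases (a i) with h | h <;> rcases abs_cases (a (m + i)) with h' | h' <;> linarith
    rw [Finset.sum_sub_distrib, ← Finset.mul_sum] at h
    linarith
  · have h : ∑ i ∈ Finset.range m, (|a i| + |a (m + i)|) ≤
        ∑ i ∈ Finset.range m, (a i - 3 * a (m + i)) := by
      refine Finset.sum_le_sum fun i hi => ?_
      obtain ⟨h₁, h₂⟩ := hab i hi
      rcases abs_cases (a i) with h | h <;> rcases abs_cases (a (m + i)) with h' | h' <;> linarith
    rw [Finset.sum_sub_distrib, ← Finset.mul_sum] at h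
    linarith
end

section
/- Let ε ∈ (0,1] and let (𝒜, ℬ) be an ε-approximate Nash equilibrium of a finite two-player game with utilities in [0,1]. Let 𝒜' be 𝒜 conditioned on the set of actions a with E_{b∼ℬ}[U^A(a,b)] ≥ max_{a'∈S_A} E_{b∼ℬ}[U^A(a',b)] − (ε + √ε) (this set has positive 𝒜-probability, so the conditioning is well-defined), and let ℬ' be defined symmetrically from ℬ. Then (𝒜', ℬ') is a 4√ε-well-supported Nash equilibrium of the game. -/
/-!
STATEMENT 13: (Daskalakis–Goldberg–Papadimitriou) Pruning an ε-approximate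
Nash equilibrium of all actions that are not (ε + √ε)-optimal yields a
4√ε-well-supported Nash equilibrium.

Mixed strategies are represented as nonnegative real-valued functions summing
to 1.  For a utility `U : SA × SB → ℝ` and an opponent mixed strategy
`B : SB → ℝ`, the expected payoff of the pure action `a` is `expPay U B a`,
and `best U B` is its maximum over the (nonempty, finite) action set.
Bob's side is handled by transposing the utility.
-/

open Finset

noncomputable section

/-- Expected payoff of the pure action `a` against the mixed strategy `B`. -/
def expPay {SA SB : Type*} [Fintype SB] (U : SA × SB → ℝ) (B : SB → ℝ) (a : SA) : ℝ :=
  ∑ b, B b * U (a, b)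

/-- `max_{a'} E_{b∼B}[U(a',b)]`. -/
def best {SA SB : Type*} [Fintype SA] [Fintype SB] [Nonempty SA]
    (U : SA × SB → ℝ) (B : SB → ℝ) : ℝ :=
  Finset.univ.sup' Finset.univ_nonempty (expPay U B)

/-- The set of actions whose expected payoff against `B` is within `t` of
optimal. -/
def goodSet {SA SB : Type*} [Fintype SA] [Fintype SB] [Nonempty SA]
    (U : SA × SB → ℝ) (B : SB → ℝ) (t : ℝ) : Finset SA :=
  Finset.univ.filter (fun a => best U B - t ≤ expPay U B a)

/-- The mixed strategy `A` conditioned on the set of `t`-optimal actions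
against `B`. -/
def condOn {SA SB : Type*} [Fintype SA] [Fintype SB] [Nonempty SA]
    (U : SA × SB → ℝ) (B : SB → ℝ) (t : ℝ) (A : SA → ℝ) : SA → ℝ :=
  fun a => if best U B - t ≤ expPay U B a then A a / (∑ a' ∈ goodSet U B t, A a') else 0

/-- The transposed utility, used for Bob's side. -/
def transp {SA SB : Type*} (U : SA × SB → ℝ) : SB × SA → ℝ := fun p => U (p.2, p.1)

end

section Pruning

variable {S T : Type*} [Fintype S] [Fintype T] [Nonempty S]

theorem expPay_le_best (U : S × T → ℝ) (B : T → ℝ) (a : S) : expPay U B a ≤ best U B :=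
  Finset.le_sup' (expPay U B) (Finset.mem_univ a)

/-- Markov's inequality for the regret of a strategy that is `s ^ 2`-optimal on average. -/
theorem one_sub_mass_goodSet_le (U : S × T → ℝ) (B : T → ℝ) (A : S → ℝ) {s : ℝ} (hs : 0 < s)
    (hA0 : ∀ a, 0 ≤ A a) (hA1 : ∑ a, A a = 1)
    (h : best U B - s ^ 2 ≤ ∑ a, A a * expPay U B a) :
    (1 - ∑ a ∈ goodSet U B (s ^ 2 + s), A a) * (1 + s) ≤ s := by
  classical
  have hbad : 1 - ∑ a ∈ goodSet U B (s ^ 2 + s), A a =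
      ∑ a, if best U B - (s ^ 2 + s) ≤ expPay U B a then 0 else A a := by
    rw [← hA1, goodSet, Finset.sum_filter, ← Finset.sum_sub_distrib]
    refine Finset.sum_congr rfl fun a _ => ?_
    split_ifs <;> ring
  have hregret : ∑ a, A a * (best U B - expPay U B a) ≤ s ^ 2 := by
    have : ∑ a, A a * (best U B - expPay U B a) = best U B - ∑ a, A a * expPay U B a := by
      simp_rw [mul_sub]
      rw [Finset.sum_sub_distrib, ← Finset.sum_mul, hA1, one_mul]
    linarith
  have hmarkov : (1 - ∑ a ∈ goodSet U B (s ^ 2 + s), A a) * (s ^ 2 + s) ≤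
      ∑ a, A a * (best U B - expPay U B a) := by
    rw [hbad, Finset.sum_mul]
    refine Finset.sum_le_sum fun a _ => ?_
    split_ifs with ha
    · rw [zero_mul]
      exact mul_nonneg (hA0 a) (sub_nonneg.2 (expPay_le_best U B a))
    · exact mul_le_mul_of_nonneg_left (by linarith) (hA0 a)
  refine le_of_mul_le_mul_right ?_ hs
  linarith

theorem mass_goodSet_pos_and_ge (U : S × T → ℝ) (B : T → ℝ) (A : S → ℝ) {s : ℝ} (hs : 0 < s)
    (hA0 : ∀ a, 0 ≤ A a) (hA1 : ∑ a, A a = 1)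
    (h : best U B - s ^ 2 ≤ ∑ a, A a * expPay U B a) :
    0 < ∑ a ∈ goodSet U B (s ^ 2 + s), A a ∧ 1 - s ≤ ∑ a ∈ goodSet U B (s ^ 2 + s), A a := by
  have hm := one_sub_mass_goodSet_le U B A hs hA0 hA1 h
  constructor <;> nlinarith

/-- Conditioning a mixed strategy moves every expected payoff by at most the discarded mass. -/
theorem abs_expPay_condOn_sub_le {R : Type*} (U : S × T → ℝ) (B : T → ℝ) (A : S → ℝ) (t : ℝ)
    (V : R × S → ℝ) (hV : ∀ p, V p ∈ Set.Icc (0 : ℝ) 1)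
    (hA0 : ∀ a, 0 ≤ A a) (hA1 : ∑ a, A a = 1) (hm : 0 < ∑ a ∈ goodSet U B t, A a) (r : R) :
    |expPay V (condOn U B t A) r - expPay V A r| ≤ 1 - ∑ a ∈ goodSet U B t, A a := by
  classical
  have hcond : expPay V (condOn U B t A) r =
      (∑ a ∈ goodSet U B t, A a * V (r, a)) / ∑ a ∈ goodSet U B t, A a := by
    rw [expPay, Finset.sum_div]
    conv_rhs => rw [goodSet, Finset.sum_filter]
    refine Finset.sum_congr rfl fun a _ => ?_
    simp only [condOn, goodSet]
    split_ifs <;> ring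
  have hsplit : expPay V A r = ∑ a ∈ goodSet U B t, A a * V (r, a) +
      ∑ a ∈ (goodSet U B t)ᶜ, A a * V (r, a) := (Finset.sum_add_sum_compl _ _).symm
  have hmass := Finset.sum_add_sum_compl (goodSet U B t) A
  have hnn (s : Finset S) : 0 ≤ ∑ a ∈ s, A a * V (r, a) :=
    Finset.sum_nonneg fun a _ => mul_nonneg (hA0 a) (hV _).1
  have hle (s : Finset S) : ∑ a ∈ s, A a * V (r, a) ≤ ∑ a ∈ s, A a :=
    Finset.sum_le_sum fun a _ => mul_le_of_le_one_right (hA0 a) (hV _).2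
  have hbad : 0 ≤ ∑ a ∈ (goodSet U B t)ᶜ, A a := Finset.sum_nonneg fun a _ => hA0 a
  have hx0 := hnn (goodSet U B t)
  have hx1 := hle (goodSet U B t)
  have hy0 := hnn (goodSet U B t)ᶜ
  have hy1 := hle (goodSet U B t)ᶜ
  rw [hcond, hsplit]
  generalize (∑ a ∈ goodSet U B t, A a * V (r, a)) = x at *
  generalize (∑ a ∈ (goodSet U B t)ᶜ, A a * V (r, a)) = y at *
  generalize (∑ a ∈ goodSet U B t, A a) = m at *
  have hq0 : 0 ≤ x / m := by positivity
  have hq1 : x / m ≤ 1 := (div_le_one hm).2 hx1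
  have hqx : x / m * m = x := div_mul_cancel₀ x hm.ne'
  rw [abs_le]
  constructor <;> nlinarith

theorem best_sub_le_of_abs_expPay_sub_le (U : S × T → ℝ) (B B' : T → ℝ) {t δ : ℝ}
    (hδ : ∀ a, |expPay U B' a - expPay U B a| ≤ δ) {a : S}
    (ha : best U B - t ≤ expPay U B a) : best U B' - (t + 2 * δ) ≤ expPay U B' a := by
  have hbest : best U B' ≤ best U B + δ := by
    refine Finset.sup'_le _ _ fun c _ => ?_
    linarith [(abs_le.1 (hδ c)).2, expPay_le_best U B c]
  linarith [(abs_le.1 (hδ a)).1]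

end Pruning

theorem stmt13 {SA SB : Type*} [Fintype SA] [Fintype SB] [Nonempty SA] [Nonempty SB]
    (UA UB : SA × SB → ℝ)
    (hUA : ∀ ab, UA ab ∈ Set.Icc (0 : ℝ) 1) (hUB : ∀ ab, UB ab ∈ Set.Icc (0 : ℝ) 1)
    (ε : ℝ) (hε0 : 0 < ε) (hε1 : ε ≤ 1)
    (A : SA → ℝ) (B : SB → ℝ)
    (hA0 : ∀ a, 0 ≤ A a) (hA1 : ∑ a, A a = 1)
    (hB0 : ∀ b, 0 ≤ B b) (hB1 : ∑ b, B b = 1)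
    -- (𝒜, ℬ) is an ε-approximate Nash equilibrium:
    (hANEA : best UA B - ε ≤ ∑ a, ∑ b, A a * B b * UA (a, b))
    (hANEB : best (transp UB) A - ε ≤ ∑ a, ∑ b, A a * B b * UB (a, b)) :
    -- the sets of (ε + √ε)-optimal actions have positive probability, so the
    -- conditionings are well-defined:
    (0 < ∑ a ∈ goodSet UA B (ε + Real.sqrt ε), A a) ∧
    (0 < ∑ b ∈ goodSet (transp UB) A (ε + Real.sqrt ε), B b) ∧
    -- (𝒜', ℬ') is a 4√ε-well-supported Nash equilibrium:
    (∀ a : SA, condOn UA B (ε + Real.sqrt ε) A a ≠ 0 →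
      best UA (condOn (transp UB) A (ε + Real.sqrt ε) B) - 4 * Real.sqrt ε ≤
        expPay UA (condOn (transp UB) A (ε + Real.sqrt ε) B) a) ∧
    (∀ b : SB, condOn (transp UB) A (ε + Real.sqrt ε) B b ≠ 0 →
      best (transp UB) (condOn UA B (ε + Real.sqrt ε) A) - 4 * Real.sqrt ε ≤
        expPay (transp UB) (condOn UA B (ε + Real.sqrt ε) A) b) := by
  have hs0 : 0 < Real.sqrt ε := Real.sqrt_pos.2 hε0
  have hs1 : Real.sqrt ε ≤ 1 := Real.sqrt_le_one.2 hε1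
  have hsq : Real.sqrt ε ^ 2 = ε := Real.sq_sqrt hε0.le
  generalize Real.sqrt ε = s at *
  subst hsq
  have hA : best UA B - s ^ 2 ≤ ∑ a, A a * expPay UA B a := by
    simpa only [expPay, Finset.mul_sum, mul_assoc] using hANEA
  have hB : best (transp UB) A - s ^ 2 ≤ ∑ b, B b * expPay (transp UB) A b := by
    refine hANEB.trans_eq ?_
    rw [Finset.sum_comm]
    simp only [expPay, transp, Finset.mul_sum, mul_assoc, mul_left_comm]
  obtain ⟨hmA, hmA'⟩ := mass_goodSet_pos_and_ge UA B A hs0 hA0 hA1 hA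
  obtain ⟨hmB, hmB'⟩ := mass_goodSet_pos_and_ge (transp UB) A B hs0 hB0 hB1 hB
  refine ⟨hmA, hmB, fun a ha => ?_, fun b hb => ?_⟩
  · have ha' : best UA B - (s ^ 2 + s) ≤ expPay UA B a := by
      by_contra hn
      exact ha (if_neg hn)
    have := best_sub_le_of_abs_expPay_sub_le UA B _ (δ := s) (fun c =>
      (abs_expPay_condOn_sub_le (transp UB) A B _ UA hUA hB0 hB1 hmB c).trans (by linarith)) ha'
    nlinarith
  · have hb' : best (transp UB) A - (s ^ 2 + s) ≤ expPay (transp UB) A b := by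
      by_contra hn
      exact hb (if_neg hn)
    have := best_sub_le_of_abs_expPay_sub_le (transp UB) A _ (δ := s) (fun c =>
      (abs_expPay_condOn_sub_le UA B A _ (transp UB) (fun p => hUB (p.2, p.1))
        hA0 hA1 hmA c).trans (by linarith)) hb'
    nlinarith
end

section
/- Let Δ ≥ 1 and let G be a finite digraph (without parallel edges) in which every vertex has in-degree at most Δ and out-degree at most Δ. Then the edge set of G can be partitioned into Δ classes such that in the subgraph formed by each class, every vertex has in-degree at most 1 and out-degree at most 1. -/
/-!
STATEMENT 15: The edges of a finite digraph with in- and out-degrees at most Δ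
can be partitioned into Δ classes, each of which has in- and out-degrees at
most 1.
-/

open Finset in
/-- A square matrix of natural numbers whose row and column sums all equal `d + 1` has a
permutation inside its support. -/
theorem exists_perm_pos_of_sum_eq {ι : Type*} [Fintype ι] (d : ℕ)
    (M : ι → ι → ℕ) (hrow : ∀ i, ∑ j, M i j = d + 1) (hcol : ∀ j, ∑ i, M i j = d + 1) :
    ∃ σ : Equiv.Perm ι, ∀ i, 0 < M i (σ i) := by
  classical
  obtain ⟨f, hf, hpos⟩ := (Finset.all_card_le_biUnion_card_iff_exists_injective
    (fun i => univ.filter (fun j => 0 < M i j))).1 (fun S => by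
      set N := S.biUnion (fun i => univ.filter (fun j => 0 < M i j)) with hN
      have h : #S * (d + 1) ≤ #N * (d + 1) := calc
        #S * (d + 1) = ∑ i ∈ S, ∑ j, M i j := by simp [hrow]
        _ = ∑ i ∈ S, ∑ j ∈ N, M i j := by
          refine sum_congr rfl fun i hi => (sum_subset (subset_univ N) fun j _ hj => ?_).symm
          by_contra hne
          exact hj (mem_biUnion.2 ⟨i, hi, by simpa using Nat.pos_of_ne_zero hne⟩)
        _ = ∑ j ∈ N, ∑ i ∈ S, M i j := sum_comm
        _ ≤ ∑ j ∈ N, ∑ i, M i j :=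
          sum_le_sum fun j _ => sum_le_sum_of_subset (subset_univ S)
        _ = #N * (d + 1) := by simp [hcol]
      exact Nat.le_of_mul_le_mul_right h d.succ_pos)
  exact ⟨Equiv.ofBijective f (Finite.injective_iff_bijective.1 hf), fun i => by
    simpa using hpos i⟩

/-- The support of a square matrix of natural numbers whose row and column sums all equal `d`
is covered by `d` permutations. -/
theorem exists_perms_cover_of_sum_eq {ι : Type*} [Fintype ι] (d : ℕ)
    (M : ι → ι → ℕ) (hrow : ∀ i, ∑ j, M i j = d) (hcol : ∀ j, ∑ i, M i j = d) :
    ∃ σ : Fin d → Equiv.Perm ι, ∀ i j, 0 < M i j → ∃ c, σ c i = j := by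
  classical
  induction d generalizing M with
  | zero =>
    refine ⟨Fin.elim0, fun i j hij => ?_⟩
    have h := Finset.sum_eq_zero_iff.1 (hrow i) j (Finset.mem_univ j)
    omega
  | succ d ih =>
    obtain ⟨τ, hτ⟩ := exists_perm_pos_of_sum_eq d M hrow hcol
    have hsplit : ∀ i j, M i j = (M i j - if τ i = j then 1 else 0) + if τ i = j then 1 else 0 := by
      intro i j
      split_ifs with h
      · have := hτ i
        rw [h] at this
        omega
      · simp
    obtain ⟨σ, hσ⟩ := ih (fun i j => M i j - if τ i = j then 1 else 0)
      (fun i => by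
        have h := hrow i
        rw [Finset.sum_congr rfl fun j _ => hsplit i j, Finset.sum_add_distrib] at h
        simpa using h)
      (fun j => by
        have h := hcol j
        rw [Finset.sum_congr rfl fun i _ => hsplit i j, Finset.sum_add_distrib] at h
        simpa [← Equiv.eq_symm_apply] using h)
    refine ⟨Fin.cons τ σ, fun i j hij => ?_⟩
    by_cases h : τ i = j
    · exact ⟨0, by simpa using h⟩
    · obtain ⟨c, hc⟩ := hσ i j (by simpa [h] using hij)
      exact ⟨c.succ, by simpa using hc⟩

/-- The support of a square matrix of natural numbers whose row and column sums are at most `d`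
is covered by `d` injective partial maps, each extended to a permutation of `ι ⊕ ι`. -/
theorem exists_perms_cover_of_sum_le {ι : Type*} [Fintype ι] (d : ℕ)
    (M : ι → ι → ℕ) (hrow : ∀ i, ∑ j, M i j ≤ d) (hcol : ∀ j, ∑ i, M i j ≤ d) :
    ∃ σ : Fin d → Equiv.Perm (ι ⊕ ι), ∀ i j, 0 < M i j → ∃ c, σ c (.inl i) = .inr j := by
  classical
  obtain ⟨σ, hσ⟩ := exists_perms_cover_of_sum_eq d
    (Sum.elim
      (fun i => Sum.elim (fun j => if i = j then d - ∑ k, M i k else 0) (fun j => M i j))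
      (fun j => Sum.elim (fun i => M i j) (fun k => if j = k then d - ∑ i, M i j else 0)))
    (by
      rintro (i | i)
      · simpa using Nat.sub_add_cancel (hrow i)
      · simpa using Nat.add_sub_cancel' (hcol i))
    (by
      rintro (i | i)
      · simpa using Nat.sub_add_cancel (hrow i)
      · simpa using Nat.add_sub_cancel' (hcol i))
  exact ⟨σ, fun i j hij => hσ (.inl i) (.inr j) (by simpa using hij)⟩

theorem stmt15 {V : Type*} [Fintype V] [DecidableEq V] (Δ : ℕ) (hΔ : 1 ≤ Δ)
    (G : Finset (V × V))
    (hout : ∀ v : V, (G.filter (fun e => e.1 = v)).card ≤ Δ)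
    (hin : ∀ v : V, (G.filter (fun e => e.2 = v)).card ≤ Δ) :
    ∃ color : V × V → Fin Δ,
      ∀ (c : Fin Δ) (v : V),
        (G.filter (fun e => color e = c ∧ e.1 = v)).card ≤ 1 ∧
        (G.filter (fun e => color e = c ∧ e.2 = v)).card ≤ 1 := by
  obtain ⟨σ, hσ⟩ := exists_perms_cover_of_sum_le Δ (fun u v => if (u, v) ∈ G then 1 else 0)
    (fun u => by
      refine le_trans (le_of_eq ?_) (hout u)
      rw [← Finset.card_filter]
      refine Finset.card_bij (fun v _ => (u, v)) (by simp) (by simp) ?_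
      rintro ⟨a, b⟩ h
      simp only [Finset.mem_filter] at h
      obtain ⟨h, rfl⟩ := h
      exact ⟨b, by simpa using h, rfl⟩)
    (fun v => by
      refine le_trans (le_of_eq ?_) (hin v)
      rw [← Finset.card_filter]
      refine Finset.card_bij (fun u _ => (u, v)) (by simp) (by simp) ?_
      rintro ⟨a, b⟩ h
      simp only [Finset.mem_filter] at h
      obtain ⟨h, rfl⟩ := h
      exact ⟨a, by simpa using h, rfl⟩)
  have hcolor : ∀ e : V × V, ∃ c : Fin Δ, e ∈ G → σ c (.inl e.1) = .inr e.2 := by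
    intro e
    by_cases he : e ∈ G
    · obtain ⟨c, hc⟩ := hσ e.1 e.2 (by simp [he])
      exact ⟨c, fun _ => hc⟩
    · exact ⟨⟨0, hΔ⟩, fun h => absurd h he⟩
  choose color hcolor using hcolor
  refine ⟨color, fun c v => ⟨?_, ?_⟩⟩ <;> rw [Finset.card_le_one] <;>
    rintro ⟨a, b⟩ h ⟨a', b'⟩ h' <;> simp only [Finset.mem_filter] at h h' <;>
    obtain ⟨hG, hc, rfl⟩ := h <;> obtain ⟨hG', hc', rfl⟩ := h' <;>
    have e := hcolor _ hG <;> have e' := hcolor _ hG' <;> rw [hc] at e <;> rw [hc'] at e'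
  · simpa using e.symm.trans e'
  · simpa using e.trans e'.symm
end
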